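/- arXiv:1810.02664 — 9 statements merged into one kernel-verified Lean document; each statement's English description precedes it below -/
import Mathlib

section
/- Let h : ℝ≥0 → ℝ≥0 be continuous with compact support and h(0) = 0, and for s,t ≥ 0 set d_h(s,t) = h(s) + h(t) − 2·min_{r ∈ [s∧t, s∨t]} h(r). Then d_h is a pseudometric on ℝ≥0: d_h(s,s) = 0, d_h is symmetric, d_h(s,t) ≥ 0, and d_h satisfies the triangle inequality d_h(s,u) ≤ d_h(s,t) + d_h(t,u). Moreover, d_h(s,t) = 0 if and only if h(s) = h(t) = min_{r ∈ [s∧t, s∨t]} h(r). -/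
open scoped NNReal

/-- The pseudometric `d_h(s,t) = h(s) + h(t) - 2 min_{r ∈ [s ∧ t, s ∨ t]} h(r)` associated
with a continuous function `h : ℝ≥0 → ℝ≥0`. The minimum over the compact interval is
expressed as the infimum of the image, which is attained since `h` is continuous. -/
noncomputable def treeDist (h : ℝ≥0 → ℝ≥0) (s t : ℝ≥0) : ℝ :=
  (h s : ℝ) + (h t : ℝ) - 2 * sInf ((fun r => (h r : ℝ)) '' Set.Icc (min s t) (max s t))

/-- If `h : ℝ≥0 → ℝ≥0` is continuous with compact support and `h 0 = 0`,
then `d_h` is a pseudometric on `ℝ≥0`: it vanishes on the diagonal, is symmetric,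
nonnegative, and satisfies the triangle inequality. Moreover `d_h(s,t) = 0` if and only if
`h(s) = h(t) = min_{r ∈ [s ∧ t, s ∨ t]} h(r)`. -/
theorem treeDist_pseudoMetric (h : ℝ≥0 → ℝ≥0) (hcont : Continuous h)
    (hsupp : HasCompactSupport h) (h0 : h 0 = 0) :
    (∀ s, treeDist h s s = 0) ∧
    (∀ s t, treeDist h s t = treeDist h t s) ∧
    (∀ s t, 0 ≤ treeDist h s t) ∧
    (∀ s t u, treeDist h s u ≤ treeDist h s t + treeDist h t u) ∧
    (∀ s t, treeDist h s t = 0 ↔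
      ((h s : ℝ) = (h t : ℝ) ∧
        (h s : ℝ) = sInf ((fun r => (h r : ℝ)) '' Set.Icc (min s t) (max s t)))) := by
  have hne : ∀ s t : ℝ≥0, ((fun r => (h r : ℝ)) '' Set.Icc (min s t) (max s t)).Nonempty :=
    fun s t => ⟨h s, s, ⟨min_le_left _ _, le_max_left _ _⟩, rfl⟩
  have hbd : ∀ s t : ℝ≥0, BddBelow ((fun r => (h r : ℝ)) '' Set.Icc (min s t) (max s t)) := by
    intro s t
    refine ⟨0, ?_⟩
    rintro _ ⟨r, _, rfl⟩
    exact (h r).2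
  have hl : ∀ s t : ℝ≥0, sInf ((fun r => (h r : ℝ)) '' Set.Icc (min s t) (max s t)) ≤ h s :=
    fun s t => csInf_le (hbd s t) ⟨s, ⟨min_le_left _ _, le_max_left _ _⟩, rfl⟩
  have hr : ∀ s t : ℝ≥0, sInf ((fun r => (h r : ℝ)) '' Set.Icc (min s t) (max s t)) ≤ h t :=
    fun s t => csInf_le (hbd s t) ⟨t, ⟨min_le_right _ _, le_max_right _ _⟩, rfl⟩
  refine ⟨?_, ?_, ?_, ?_, ?_⟩
  · intro s
    simp only [treeDist, min_self, max_self, Set.Icc_self, Set.image_singleton, csInf_singleton]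
    ring
  · intro s t
    simp only [treeDist, min_comm s t, max_comm s t]
    ring
  · intro s t
    have h1 := hl s t
    have h2 := hr s t
    unfold treeDist
    linarith
  · intro s t u
    have h1 := hr s t
    have h2 := hl t u
    have h3 : min (sInf ((fun r => (h r : ℝ)) '' Set.Icc (min s t) (max s t)))
        (sInf ((fun r => (h r : ℝ)) '' Set.Icc (min t u) (max t u))) ≤
        sInf ((fun r => (h r : ℝ)) '' Set.Icc (min s u) (max s u)) := by
      apply le_csInf (hne s u)
      rintro _ ⟨r, hr', rfl⟩
      have hm : r ∈ Set.Icc (min s t) (max s t) ∪ Set.Icc (min t u) (max t u) :=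
        Set.uIcc_subset_uIcc_union_uIcc hr'
      rcases hm with hm | hm
      · exact (min_le_left _ _).trans (csInf_le (hbd s t) ⟨r, hm, rfl⟩)
      · exact (min_le_right _ _).trans (csInf_le (hbd t u) ⟨r, hm, rfl⟩)
    unfold treeDist
    rcases min_le_iff.1 h3 with h4 | h4 <;> linarith
  · intro s t
    have h1 := hl s t
    have h2 := hr s t
    unfold treeDist
    constructor
    · intro h3
      constructor <;> linarith
    · rintro ⟨h3, h4⟩
      linarith
end

section
/- Let h : ℝ≥0 → ℝ≥0 be continuous with compact support and h(0) = 0, and let d_h(s,t) = h(s) + h(t) − 2·min_{r ∈ [s∧t, s∨t]} h(r). Then the quotient metric space T_h = ℝ≥0/∼_h, where s ∼_h t iff d_h(s,t) = 0, equipped with the metric induced by d_h, is a compact metric space. -/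
open scoped NNReal

theorem treeDist_exists (h : ℝ≥0 → ℝ≥0) (hcont : Continuous h) (s t : ℝ≥0) :
    ∃ m ∈ Set.Icc (min s t) (max s t), treeDist h s t = h s + h t - 2 * h m ∧
      ∀ r ∈ Set.Icc (min s t) (max s t), (h m : ℝ) ≤ h r := by
  have hc : Continuous (fun r => (h r : ℝ)) := NNReal.continuous_coe.comp hcont
  obtain ⟨m, hm, hmin⟩ := (isCompact_Icc (a := min s t) (b := max s t)).exists_isMinOn
    (Set.nonempty_Icc.2 min_le_max) hc.continuousOn
  refine ⟨m, hm, ?_, fun r hr => hmin hr⟩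
  have : IsLeast ((fun r => (h r : ℝ)) '' Set.Icc (min s t) (max s t)) (h m) := by
    refine ⟨⟨m, hm, rfl⟩, ?_⟩
    rintro _ ⟨r, hr, rfl⟩
    exact hmin hr
  rw [treeDist, this.csInf_eq]

theorem treeDist_self' (h : ℝ≥0 → ℝ≥0) (s : ℝ≥0) : treeDist h s s = 0 := by
  simp [treeDist]; ring

theorem treeDist_comm' (h : ℝ≥0 → ℝ≥0) (s t : ℝ≥0) : treeDist h s t = treeDist h t s := by
  simp only [treeDist, min_comm s t, max_comm s t]; ring

theorem treeDist_triangle' (h : ℝ≥0 → ℝ≥0) (hcont : Continuous h) (s u t : ℝ≥0) :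
    treeDist h s t ≤ treeDist h s u + treeDist h u t := by
  obtain ⟨a, ha, ea, la⟩ := treeDist_exists h hcont s t
  obtain ⟨b, hb, eb, lb⟩ := treeDist_exists h hcont s u
  obtain ⟨c, hc, ec, lc⟩ := treeDist_exists h hcont u t
  have h1 := lb u (by simp)
  have h2 := lc u (by simp)
  have : a ∈ Set.Icc (min s u) (max s u) ∨ a ∈ Set.Icc (min u t) (max u t) := by
    simp only [Set.mem_Icc, min_le_iff, le_max_iff] at *
    rcases le_total a u with h | h <;> grind
  rcases this with h3 | h3
  · have := lb a h3
    linarith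
  · have := lc a h3
    linarith

/-- Type synonym carrying the pseudometric. -/
def TreePre (_ : ℝ≥0 → ℝ≥0) : Type := ℝ≥0

/-- If `h : ℝ≥0 → ℝ≥0` is continuous with compact support and `h 0 = 0`,
then the quotient metric space `T_h = ℝ≥0 / ∼_h` (where `s ∼_h t` iff `d_h(s,t) = 0`),
equipped with the metric induced by `d_h`, is a compact metric space. It is formalized as
the existence of a metric space `T` together with a surjection `p : ℝ≥0 → T` satisfying
`dist (p s) (p t) = d_h(s,t)` (so that `p` identifies exactly the pairs with `d_h = 0`,
i.e. `T` is the metric quotient), such that `T` is compact. -/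
theorem treeQuotient_compact (h : ℝ≥0 → ℝ≥0) (hcont : Continuous h)
    (hsupp : HasCompactSupport h) (h0 : h 0 = 0) :
    ∃ (T : Type) (_ : MetricSpace T) (p : ℝ≥0 → T),
      Function.Surjective p ∧
      (∀ s t, dist (p s) (p t) = treeDist h s t) ∧
      CompactSpace T := by
  letI : PseudoMetricSpace (TreePre h) :=
    { dist := fun s t => treeDist h s t
      dist_self := treeDist_self' h
      dist_comm := treeDist_comm' h
      dist_triangle := fun s u t => treeDist_triangle' h hcont s u t }
  let q : ℝ≥0 → TreePre h := fun s => s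
  have hq : ∀ s t, dist (q s) (q t) = treeDist h s t := fun s t => rfl
  have hqc : Continuous q := by
    rw [continuous_iff_continuousAt]
    intro s
    rw [ContinuousAt, Metric.tendsto_nhds]
    intro ε hε
    obtain ⟨δ, hδ, hb⟩ := Metric.continuousAt_iff.1 (hcont.continuousAt (x := s)) (ε / 4)
      (by positivity)
    filter_upwards [Metric.ball_mem_nhds s hδ] with t ht
    obtain ⟨m, hm, e, -⟩ := treeDist_exists h hcont t s
    have ht' : |(t : ℝ) - s| < δ := by simpa [NNReal.dist_eq] using ht
    have hm' : dist m s < δ := by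
      rw [NNReal.dist_eq]
      simp only [Set.mem_Icc, min_le_iff, le_max_iff, ← NNReal.coe_le_coe] at hm
      rw [abs_lt] at *
      grind
    have k1 := hb ht
    have k2 := hb hm'
    rw [NNReal.dist_eq, abs_lt] at k1 k2
    rw [hq, e]
    linarith [k1.1, k1.2, k2.1, k2.2]
  have hpc : Continuous (fun s => SeparationQuotient.mk (q s)) :=
    SeparationQuotient.continuous_mk.comp hqc
  have hsurj : Function.Surjective (fun s => SeparationQuotient.mk (q s)) := by
    intro x
    obtain ⟨y, hy⟩ := SeparationQuotient.surjective_mk x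
    exact ⟨y, hy⟩
  refine ⟨SeparationQuotient (TreePre h), inferInstance, fun s => SeparationQuotient.mk (q s),
    hsurj, fun s t => ?_, ?_⟩
  · rw [SeparationQuotient.dist_mk, hq]
  · have hK : IsCompact (tsupport h ∪ {0}) := IsCompact.union hsupp isCompact_singleton
    refine ⟨(hK.image hpc).of_isClosed_subset isClosed_univ ?_⟩
    intro x _
    obtain ⟨s, rfl⟩ := hsurj x
    by_cases hs : s ∈ tsupport h
    · exact ⟨s, Or.inl hs, rfl⟩
    · refine ⟨0, Or.inr rfl, ?_⟩
      have hs0 : h s = 0 := image_eq_zero_of_notMem_tsupport hs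
      apply eq_of_dist_eq_zero
      refine (SeparationQuotient.dist_mk _ _).trans ?_
      rw [hq]
      obtain ⟨m, hm, e, l⟩ := treeDist_exists h hcont 0 s
      have := l 0 (by simp)
      have h2 : (0 : ℝ) ≤ h m := (h m).2
      rw [h0, NNReal.coe_zero] at this
      rw [e, h0, hs0, le_antisymm this h2]
      simp
end

section
/- Let h : ℝ≥0 → ℝ≥0 be continuous with compact support and h(0) = 0, and let T_h be the tree coded by h with metric d induced by d_h. Then T_h is a geodesic space: for every a, b ∈ T_h there exists a map γ : [0, d(a,b)] → T_h with γ(0) = a, γ(d(a,b)) = b, and d(γ(u), γ(v)) = |u − v| for all u, v ∈ [0, d(a,b)]. -/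
open scoped NNReal

theorem td_eq (h : ℝ≥0 → ℝ≥0) (s t q : ℝ≥0) (m : ℝ) (hst : s ≤ t) (h1 : s ≤ q) (h2 : q ≤ t)
    (hq : (h q : ℝ) = m) (hm : ∀ r, s ≤ r → r ≤ t → m ≤ h r) :
    treeDist h s t = h s + h t - 2 * m := by
  have : IsLeast ((fun r => (h r : ℝ)) '' Set.Icc (min s t) (max s t)) m := by
    rw [min_eq_left hst, max_eq_right hst]
    refine ⟨⟨q, ⟨h1, h2⟩, hq⟩, ?_⟩
    rintro _ ⟨r, ⟨ha, hb⟩, rfl⟩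
    exact hm r ha hb
  rw [treeDist, this.csInf_eq]

theorem ex_down (h : ℝ≥0 → ℝ≥0) (hc : Continuous h) (s r₀ : ℝ≥0) (hs : s ≤ r₀) (x : ℝ)
    (h1 : h r₀ ≤ x) (h2 : x ≤ h s) :
    ∃ r, s ≤ r ∧ r ≤ r₀ ∧ (h r : ℝ) = x ∧ ∀ q, s ≤ q → q ≤ r → x ≤ h q := by
  have hf : Continuous (fun r => (h r : ℝ)) := NNReal.continuous_coe.comp hc
  have hK : IsCompact (Set.Icc s r₀ ∩ {r | (h r : ℝ) ≤ x}) :=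
    isCompact_Icc.inter_right (isClosed_le hf continuous_const)
  obtain ⟨r, ⟨⟨hr1, hr2⟩, hr3⟩, hl⟩ := hK.exists_isLeast ⟨r₀, ⟨hs, le_rfl⟩, h1⟩
  have hr3 : (h r : ℝ) ≤ x := hr3
  have e : (h r : ℝ) = x := by
    obtain ⟨q, ⟨hq1, hq2⟩, hq⟩ := intermediate_value_Icc' hr1 hf.continuousOn ⟨hr3, h2⟩
    have hq : (h q : ℝ) = x := hq
    have : r ≤ q := hl ⟨⟨hq1, hq2.trans hr2⟩, hq.le⟩
    rw [le_antisymm this hq2, hq]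
  refine ⟨r, hr1, hr2, e, fun q a b => ?_⟩
  by_contra hlt
  push Not at hlt
  have : r ≤ q := hl ⟨⟨a, b.trans hr2⟩, hlt.le⟩
  rw [le_antisymm b this] at hlt
  linarith

theorem ex_up (h : ℝ≥0 → ℝ≥0) (hc : Continuous h) (r₀ t : ℝ≥0) (hs : r₀ ≤ t) (x : ℝ)
    (h1 : h r₀ ≤ x) (h2 : x ≤ h t) :
    ∃ r, r₀ ≤ r ∧ r ≤ t ∧ (h r : ℝ) = x ∧ ∀ q, r ≤ q → q ≤ t → x ≤ h q := by
  have hf : Continuous (fun r => (h r : ℝ)) := NNReal.continuous_coe.comp hc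
  have hK : IsCompact (Set.Icc r₀ t ∩ {r | (h r : ℝ) ≤ x}) :=
    isCompact_Icc.inter_right (isClosed_le hf continuous_const)
  obtain ⟨r, ⟨⟨hr1, hr2⟩, hr3⟩, hl⟩ := hK.exists_isGreatest ⟨r₀, ⟨le_rfl, hs⟩, h1⟩
  have hr3 : (h r : ℝ) ≤ x := hr3
  have e : (h r : ℝ) = x := by
    obtain ⟨q, ⟨hq1, hq2⟩, hq⟩ := intermediate_value_Icc hr2 hf.continuousOn ⟨hr3, h2⟩
    have hq : (h q : ℝ) = x := hq
    have : q ≤ r := hl ⟨⟨hr1.trans hq1, hq2⟩, hq.le⟩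
    rw [← le_antisymm this hq1, hq]
  refine ⟨r, hr1, hr2, e, fun q a b => ?_⟩
  by_contra hlt
  push Not at hlt
  have : q ≤ r := hl ⟨⟨hr1.trans a, b⟩, hlt.le⟩
  rw [le_antisymm this a] at hlt
  linarith

theorem geo_aux (h : ℝ≥0 → ℝ≥0) (hcont : Continuous h)
    (T : Type*) [MetricSpace T] (p : ℝ≥0 → T)
    (hdist : ∀ s t, dist (p s) (p t) = treeDist h s t) (s t : ℝ≥0) (hst : s ≤ t) :
    ∃ γ : ℝ → T,
      γ 0 = p s ∧ γ (dist (p s) (p t)) = p t ∧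
      ∀ u ∈ Set.Icc (0 : ℝ) (dist (p s) (p t)), ∀ v ∈ Set.Icc (0 : ℝ) (dist (p s) (p t)),
        dist (γ u) (γ v) = |u - v| := by
  have hf : Continuous (fun r => (h r : ℝ)) := NNReal.continuous_coe.comp hcont
  obtain ⟨r₀, ⟨hr1, hr2⟩, hmin⟩ :=
    isCompact_Icc.exists_isMinOn (Set.nonempty_Icc.2 hst) hf.continuousOn
  have hmin : ∀ r, s ≤ r → r ≤ t → (h r₀ : ℝ) ≤ h r := fun r a b => hmin ⟨a, b⟩
  have hA : ∀ x : ℝ, ∃ r, (h r₀ : ℝ) ≤ x → x ≤ h s →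
      s ≤ r ∧ r ≤ r₀ ∧ (h r : ℝ) = x ∧ ∀ q, s ≤ q → q ≤ r → x ≤ h q := by
    intro x
    by_cases hx : (h r₀ : ℝ) ≤ x ∧ x ≤ h s
    · obtain ⟨r, hr⟩ := ex_down h hcont s r₀ hr1 x hx.1 hx.2
      exact ⟨r, fun _ _ => hr⟩
    · exact ⟨0, fun a b => absurd ⟨a, b⟩ hx⟩
  have hB : ∀ x : ℝ, ∃ r, (h r₀ : ℝ) ≤ x → x ≤ h t →
      r₀ ≤ r ∧ r ≤ t ∧ (h r : ℝ) = x ∧ ∀ q, r ≤ q → q ≤ t → x ≤ h q := by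
    intro x
    by_cases hx : (h r₀ : ℝ) ≤ x ∧ x ≤ h t
    · obtain ⟨r, hr⟩ := ex_up h hcont r₀ t hr2 x hx.1 hx.2
      exact ⟨r, fun _ _ => hr⟩
    · exact ⟨0, fun a b => absurd ⟨a, b⟩ hx⟩
  choose α hα using hA
  choose β hβ using hB
  have hs0 := hmin s le_rfl hst
  have ht0 := hmin t hst le_rfl
  have hD : dist (p s) (p t) = h s + h t - 2 * h r₀ := by
    rw [hdist]; exact td_eq h s t r₀ _ hst hr1 hr2 rfl hmin
  have hαα : ∀ x y : ℝ, (h r₀ : ℝ) ≤ x → x ≤ y → y ≤ h s →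
      dist (p (α x)) (p (α y)) = y - x := by
    intro x y h1 h2 h3
    rcases h2.eq_or_lt with rfl | hlt
    · simp
    obtain ⟨a1, a2, a3, a4⟩ := hα x h1 (h2.trans h3)
    obtain ⟨b1, b2, b3, b4⟩ := hα y (h1.trans h2) h3
    have hle : α y ≤ α x := by
      by_contra hh
      push Not at hh
      have := b4 _ a1 hh.le
      linarith
    rw [dist_comm, hdist, td_eq h _ _ (α x) x hle hle le_rfl a3
      (fun r c d => a4 r (b1.trans c) d)]
    linarith
  have hββ : ∀ x y : ℝ, (h r₀ : ℝ) ≤ x → x ≤ y → y ≤ h t →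
      dist (p (β x)) (p (β y)) = y - x := by
    intro x y h1 h2 h3
    rcases h2.eq_or_lt with rfl | hlt
    · simp
    obtain ⟨a1, a2, a3, a4⟩ := hβ x h1 (h2.trans h3)
    obtain ⟨b1, b2, b3, b4⟩ := hβ y (h1.trans h2) h3
    have hle : β x ≤ β y := by
      by_contra hh
      push Not at hh
      have := b4 _ hh.le a2
      linarith
    rw [hdist, td_eq h _ _ (β x) x hle le_rfl hle a3
      (fun r c d => a4 r c (d.trans b2))]
    linarith
  have hαβ : ∀ x y : ℝ, (h r₀ : ℝ) ≤ x → x ≤ h s → (h r₀ : ℝ) ≤ y → y ≤ h t →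
      dist (p (α x)) (p (β y)) = x + y - 2 * h r₀ := by
    intro x y h1 h2 h3 h4
    obtain ⟨a1, a2, a3, a4⟩ := hα x h1 h2
    obtain ⟨b1, b2, b3, b4⟩ := hβ y h3 h4
    rw [hdist, td_eq h _ _ r₀ _ (a2.trans b1) a2 b1 rfl
      (fun r c d => hmin r (a1.trans c) (d.trans b2)), a3, b3]
  have hαs : p (α (h s)) = p s := by
    obtain ⟨a1, a2, a3, a4⟩ := hα (h s) hs0 le_rfl
    rw [eq_comm, ← dist_eq_zero, hdist, td_eq h _ _ s _ a1 le_rfl a1 rfl a4]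
    linarith
  have hβt : p (β (h t)) = p t := by
    obtain ⟨a1, a2, a3, a4⟩ := hβ (h t) ht0 le_rfl
    rw [← dist_eq_zero, hdist, td_eq h _ _ t _ a2 a2 le_rfl rfl a4]
    linarith
  have key : ∀ u v : ℝ, 0 ≤ u → u ≤ v → v ≤ h s + h t - 2 * h r₀ →
      dist (if u ≤ h s - h r₀ then p (α (h s - u)) else p (β (u - h s + 2 * h r₀)))
        (if v ≤ h s - h r₀ then p (α (h s - v)) else p (β (v - h s + 2 * h r₀))) = v - u := by
    intro u v hu huv hv
    split_ifs with c1 c2 c2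
    · rw [dist_comm, hαα _ _ (by linarith) (by linarith) (by linarith)]; ring
    · rw [hαβ _ _ (by linarith) (by linarith) (by linarith) (by linarith)]; ring
    · exact absurd (huv.trans c2) c1
    · push Not at c1 c2
      rw [hββ _ _ (by linarith) (by linarith) (by linarith)]; ring
  refine ⟨fun u => if u ≤ h s - h r₀ then p (α (h s - u)) else p (β (u - h s + 2 * h r₀)),
    ?_, ?_, ?_⟩
  · simp only
    rw [if_pos (by linarith), sub_zero, hαs]
  · simp only [hD]
    split_ifs with c
    · have : (h t : ℝ) = h r₀ := by linarith
      rw [← hβt, ← dist_eq_zero,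
        hαβ _ _ (by linarith) (by linarith) (by linarith) (by linarith)]
      linarith
    · rw [← hβt]; congr 2; ring
  · rw [hD]
    rintro u ⟨hu1, hu2⟩ v ⟨hv1, hv2⟩
    rcases le_total u v with huv | huv
    · rw [abs_sub_comm, abs_of_nonneg (by linarith)]
      exact key u v hu1 huv hv2
    · rw [abs_of_nonneg (by linarith), dist_comm]
      exact key v u hv1 huv hu2

/-- Let `h : ℝ≥0 → ℝ≥0` be continuous with compact support and `h 0 = 0`,
and let `T` be the tree coded by `h`, i.e. a metric space together with a surjection
`p : ℝ≥0 → T` such that `dist (p s) (p t) = d_h(s,t)` (the metric quotient of `d_h`).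
Then `T` is a geodesic space: for all `a b : T` there is a map `γ` defined on
`[0, dist a b]` with `γ 0 = a`, `γ (dist a b) = b` and `dist (γ u) (γ v) = |u - v|`. -/
theorem treeQuotient_geodesic (h : ℝ≥0 → ℝ≥0) (hcont : Continuous h)
    (hsupp : HasCompactSupport h) (h0 : h 0 = 0)
    (T : Type*) [MetricSpace T] (p : ℝ≥0 → T)
    (hsurj : Function.Surjective p)
    (hdist : ∀ s t, dist (p s) (p t) = treeDist h s t) :
    ∀ a b : T, ∃ γ : ℝ → T,
      γ 0 = a ∧ γ (dist a b) = b ∧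
      ∀ u ∈ Set.Icc (0 : ℝ) (dist a b), ∀ v ∈ Set.Icc (0 : ℝ) (dist a b),
        dist (γ u) (γ v) = |u - v| := by
  intro a b
  obtain ⟨s, rfl⟩ := hsurj a
  obtain ⟨t, rfl⟩ := hsurj b
  rcases le_total s t with hst | hst
  · exact geo_aux h hcont T p hdist s t hst
  · obtain ⟨γ, g0, g1, g2⟩ := geo_aux h hcont T p hdist t s hst
    rw [dist_comm (p s) (p t)]
    refine ⟨fun u => γ (dist (p t) (p s) - u), by simpa using g1, by simpa using g0, ?_⟩
    rintro u ⟨hu1, hu2⟩ v ⟨hv1, hv2⟩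
    have := g2 (dist (p t) (p s) - u) ⟨by linarith, by linarith⟩
      (dist (p t) (p s) - v) ⟨by linarith, by linarith⟩
    simp only
    rw [this, abs_sub_comm u v]
    congr 1
    ring
end

section
/- Let h : ℝ≥0 → ℝ≥0 be continuous with compact support and h(0) = 0, and let T_h be the tree coded by h. Then arcs in T_h are unique: if γ, γ' : [0,1] → T_h are continuous injective maps with γ(0) = γ'(0) and γ(1) = γ'(1), then the range of γ equals the range of γ'. -/
open scoped NNReal

lemma inf_ultra (h : ℝ≥0 → ℝ≥0) (m : ℝ≥0 → ℝ≥0 → ℝ)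
    (hm : ∀ s t, m s t = sInf ((fun r => (h r : ℝ)) '' Set.Icc (min s t) (max s t)))
    (x y z : ℝ≥0) : min (m x y) (m y z) ≤ m x z := by
  have key : ∀ s t r, r ∈ Set.Icc (min s t) (max s t) → m s t ≤ h r := by
    intro s t r hr
    rw [hm]
    exact csInf_le ⟨0, by rintro _ ⟨w, _, rfl⟩; exact (h w).2⟩ ⟨r, hr, rfl⟩
  rw [hm x z]
  apply le_csInf
  · exact ⟨h x, x, ⟨min_le_left _ _, le_max_left _ _⟩, rfl⟩
  rintro _ ⟨r, hr, rfl⟩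
  have : r ∈ Set.uIcc x y ∪ Set.uIcc y z := Set.uIcc_subset_uIcc_union_uIcc hr
  rcases this with h1 | h1
  · exact (min_le_left _ _).trans (key _ _ _ h1)
  · exact (min_le_right _ _).trans (key _ _ _ h1)

lemma four_point (h : ℝ≥0 → ℝ≥0) (x y z w : ℝ≥0) :
    treeDist h x y + treeDist h z w ≤
      max (treeDist h x z + treeDist h y w) (treeDist h x w + treeDist h y z) := by
  obtain ⟨m, hm⟩ : ∃ m : ℝ≥0 → ℝ≥0 → ℝ, ∀ s t, m s t =
    sInf ((fun r => (h r : ℝ)) '' Set.Icc (min s t) (max s t)) := ⟨_, fun _ _ => rfl⟩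
  have symm : ∀ s t, m s t = m t s := by
    intro s t; rw [hm, hm, min_comm, max_comm]
  have u := inf_ultra h m hm
  simp only [treeDist, ← hm]
  by_contra! hc
  obtain ⟨hc1, hc2⟩ := max_lt_iff.1 hc
  have a1 := u x z y
  have a2 := u x w y
  have a3 := u z x w
  have a4 := u z y w
  have b1 := u x y z
  have b2 := u x w z
  have b3 := u x y w
  have b4 := u x z w
  have b5 := u y x z
  have b6 := u y w z
  have b7 := u y x w
  have b8 := u y z w
  rw [symm z y] at *
  rw [symm w y] at *
  rw [symm z x] at *
  rw [symm y x] at *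
  rw [symm w z] at *
  generalize m x y = A at *
  generalize m x z = B at *
  generalize m x w = C at *
  generalize m y z = D at *
  generalize m y w = E at *
  generalize m z w = F at *
  clear hm symm u hc
  rcases min_le_iff.1 a1 with a1 | a1 <;> rcases min_le_iff.1 a2 with a2 | a2 <;>
  rcases min_le_iff.1 a3 with a3 | a3 <;> rcases min_le_iff.1 a4 with a4 | a4 <;>
  first | linarith | grind

section
variable {T : Type*} [MetricSpace T]

lemma level_hit
    (H : ∀ x y z w : T, dist x y + dist z w ≤ max (dist x z + dist y w) (dist x w + dist y z))
    (γ : Set.Icc (0 : ℝ) 1 → T) (hγ : Continuous γ) (a b : T)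
    (ha : γ ⟨0, by norm_num⟩ = a) (hb : γ ⟨1, by norm_num⟩ = b)
    (l : ℝ) (hl : l ∈ Set.Icc 0 (dist a b)) :
    ∃ u, dist a (γ u) = l ∧ dist (γ u) b = dist a b - l := by
  by_contra! hne
  have hl0 : 0 < l := by
    rcases hl.1.eq_or_lt with h | h
    · subst h
      exact absurd (by rw [ha]; simp) (hne ⟨0, by norm_num⟩ (by rw [ha]; simp))
    · exact h
  have hl1 : l < dist a b := by
    rcases hl.2.eq_or_lt with h | h
    · subst h
      exact absurd (by rw [hb]; simp) (hne ⟨1, by norm_num⟩ (by rw [hb]))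
    · exact h
  let A : Set (Set.Icc (0:ℝ) 1) :=
    {u | dist a (γ u) - l < dist (γ u) b - (dist a b - l)}
  have hAo : IsOpen A := isOpen_lt (by fun_prop) (by fun_prop)
  have hAc : IsClosed A := by
    rw [← isOpen_compl_iff, isOpen_iff_mem_nhds]
    intro u hu
    have hu' : dist (γ u) b - (dist a b - l) ≤ dist a (γ u) - l := not_lt.1 hu
    have hg : 0 < dist a (γ u) - l := by
      by_contra! hle
      have tri := dist_triangle a (γ u) b
      exact hne u (by linarith) (by linarith)
    have hc : Filter.Tendsto (fun v => dist (γ u) (γ v)) (nhds u) (nhds 0) := by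
      have : Continuous (fun v => dist (γ u) (γ v)) := by fun_prop
      simpa using this.tendsto u
    filter_upwards [hc.eventually_lt_const hg] with v hv hvA
    have hv2 : dist a (γ v) - l < dist (γ v) b - (dist a b - l) := hvA
    have tri := dist_triangle a (γ v) b
    have := H a (γ u) b (γ v)
    rw [dist_comm b, dist_comm (γ u) b] at this
    rcases le_max_iff.1 this with h | h
    · linarith
    · rw [dist_comm b] at h
      linarith
  have hA : A = Set.univ := IsClopen.eq_univ ⟨hAc, hAo⟩ ⟨⟨0, by norm_num⟩, by
    simp only [A, Set.mem_ofPred_eq, ha, dist_self]; linarith⟩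
  have : (⟨1, by norm_num⟩ : Set.Icc (0:ℝ) 1) ∈ A := hA ▸ Set.mem_univ _
  simp only [A, Set.mem_ofPred_eq, hb, dist_self] at this
  linarith

lemma arc_range
    (H : ∀ x y z w : T, dist x y + dist z w ≤ max (dist x z + dist y w) (dist x w + dist y z))
    (γ : Set.Icc (0 : ℝ) 1 → T) (hγ : Continuous γ) (hinj : Function.Injective γ) (a b : T)
    (ha : γ ⟨0, by norm_num⟩ = a) (hb : γ ⟨1, by norm_num⟩ = b) :
    Set.range γ = {c | dist a c + dist c b = dist a b} := by
  set S := {c | dist a c + dist c b = dist a b} with hS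
  have iso : ∀ c ∈ S, ∀ c' ∈ S, dist c c' ≤ |dist a c - dist a c'| := by
    intro c hc c' hc'
    simp only [hS, Set.mem_ofPred_eq] at hc hc'
    have := H a b c c'
    rw [dist_comm b c, dist_comm b c'] at this
    rcases le_max_iff.1 this with h | h
    · have := le_abs_self (dist a c - dist a c')
      linarith
    · have := neg_abs_le (dist a c - dist a c')
      linarith
  have hit := level_hit H γ hγ a b ha hb
  have hSsub : S ⊆ Set.range γ := by
    intro c hc
    have hc2 : dist a c + dist c b = dist a b := hc
    obtain ⟨u, h1, h2⟩ := hit (dist a c) ⟨dist_nonneg, by linarith [dist_nonneg (x := c) (y := b)]⟩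
    refine ⟨u, ?_⟩
    have := iso (γ u) (by simp only [hS, Set.mem_ofPred_eq]; linarith) c hc
    rw [h1, sub_self, abs_zero] at this
    exact dist_le_zero.1 this
  have hconn : IsPreconnected S := by
    have : ∀ l, ∃ c, l ∈ Set.Icc 0 (dist a b) → c ∈ S ∧ dist a c = l := by
      intro l
      by_cases hl : l ∈ Set.Icc 0 (dist a b)
      · obtain ⟨u, h1, h2⟩ := hit l hl
        exact ⟨γ u, fun _ => ⟨by simp only [hS, Set.mem_ofPred_eq]; linarith, h1⟩⟩
      · exact ⟨a, fun h => absurd h hl⟩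
    choose φ hφ using this
    have himg : S = φ '' Set.Icc 0 (dist a b) := by
      ext c
      constructor
      · intro hc
        have hc2 : dist a c + dist c b = dist a b := hc
        have hm : dist a c ∈ Set.Icc 0 (dist a b) :=
          ⟨dist_nonneg, by linarith [dist_nonneg (x := c) (y := b)]⟩
        refine ⟨dist a c, hm, ?_⟩
        have := iso _ (hφ _ hm).1 c hc
        rw [(hφ _ hm).2, sub_self, abs_zero] at this
        exact dist_le_zero.1 this
      · rintro ⟨l, hl, rfl⟩
        exact (hφ l hl).1
    rw [himg]
    apply isPreconnected_Icc.image
    apply LipschitzOnWith.continuousOn (K := 1)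
    apply LipschitzOnWith.of_dist_le_mul
    intro l hl l' hl'
    have := iso _ (hφ _ hl).1 _ (hφ _ hl').1
    rw [(hφ _ hl).2, (hφ _ hl').2] at this
    simpa [Real.dist_eq] using this
  apply subset_antisymm _ hSsub
  have hpre : IsPreconnected (γ ⁻¹' S) :=
    hconn.preimage_of_isClosedMap hinj hγ.isClosedMap hSsub
  have hord := hpre.ordConnected
  rintro _ ⟨u, rfl⟩
  have h0 : (⟨0, by norm_num⟩ : Set.Icc (0:ℝ) 1) ∈ γ ⁻¹' S := by
    change dist a (γ _) + dist (γ _) b = dist a b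
    rw [ha]; simp
  have h1 : (⟨1, by norm_num⟩ : Set.Icc (0:ℝ) 1) ∈ γ ⁻¹' S := by
    change dist a (γ _) + dist (γ _) b = dist a b
    rw [hb]; simp
  exact hord.out h0 h1 ⟨u.2.1, u.2.2⟩
end



/-- Let `h : ℝ≥0 → ℝ≥0` be continuous with compact support and `h 0 = 0`,
and let `T` be the tree coded by `h`, i.e. a metric space together with a surjection
`p : ℝ≥0 → T` such that `dist (p s) (p t) = d_h(s,t)` (the metric quotient of `d_h`).
Then arcs in `T` are unique: two continuous injective maps `γ, γ' : [0,1] → T` with the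
same endpoints have the same range. -/
theorem treeQuotient_arc_unique (h : ℝ≥0 → ℝ≥0) (hcont : Continuous h)
    (hsupp : HasCompactSupport h) (h0 : h 0 = 0)
    (T : Type*) [MetricSpace T] (p : ℝ≥0 → T)
    (hsurj : Function.Surjective p)
    (hdist : ∀ s t, dist (p s) (p t) = treeDist h s t)
    (γ γ' : Set.Icc (0 : ℝ) 1 → T)
    (hγ : Continuous γ) (hγ' : Continuous γ')
    (hinj : Function.Injective γ) (hinj' : Function.Injective γ')
    (h₀ : γ ⟨0, by norm_num⟩ = γ' ⟨0, by norm_num⟩)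
    (h₁ : γ ⟨1, by norm_num⟩ = γ' ⟨1, by norm_num⟩) :
    Set.range γ = Set.range γ' := by
  have H : ∀ x y z w : T,
      dist x y + dist z w ≤ max (dist x z + dist y w) (dist x w + dist y z) := by
    intro x y z w
    obtain ⟨x, rfl⟩ := hsurj x
    obtain ⟨y, rfl⟩ := hsurj y
    obtain ⟨z, rfl⟩ := hsurj z
    obtain ⟨w, rfl⟩ := hsurj w
    simp only [hdist]
    exact four_point h x y z w
  rw [arc_range H γ hγ hinj _ _ rfl rfl, arc_range H γ' hγ' hinj' _ _ rfl rfl, h₀, h₁]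
end

section
/- Let h : ℝ≥0 → ℝ≥0 be continuous with compact support and h(0) = 0, and let d_h(s,t) = h(s) + h(t) − 2·min_{r ∈ [s∧t, s∨t]} h(r). Then d_h satisfies the four-point condition: for all s, t, u, v ∈ ℝ≥0, d_h(s,t) + d_h(u,v) ≤ max( d_h(s,u) + d_h(t,v), d_h(s,v) + d_h(t,u) ). -/
open scoped NNReal

theorem aux_min (h : ℝ≥0 → ℝ≥0) (s t u : ℝ≥0) :
    min (sInf ((fun r => (h r : ℝ)) '' Set.Icc (min s t) (max s t)))
      (sInf ((fun r => (h r : ℝ)) '' Set.Icc (min t u) (max t u))) ≤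
      sInf ((fun r => (h r : ℝ)) '' Set.Icc (min s u) (max s u)) := by
  have bdd : ∀ S : Set ℝ≥0, BddBelow ((fun r => (h r : ℝ)) '' S) := by
    intro S
    refine ⟨0, ?_⟩
    rintro _ ⟨r, _, rfl⟩
    exact (h r).2
  apply le_csInf
  · exact ⟨_, s, ⟨min_le_left _ _, le_max_left _ _⟩, rfl⟩
  · rintro _ ⟨r, ⟨h1, h2⟩, rfl⟩
    have : (min s t ≤ r ∧ r ≤ max s t) ∨ (min t u ≤ r ∧ r ≤ max t u) := by
      rcases le_total r t with h3 | h3 <;> rcases min_le_iff.1 h1 with h4 | h4 <;>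
        rcases le_max_iff.1 h2 with h5 | h5 <;> simp [*]
    rcases this with h3 | h3
    · exact (min_le_left _ _).trans (csInf_le (bdd _) ⟨r, h3, rfl⟩)
    · exact (min_le_right _ _).trans (csInf_le (bdd _) ⟨r, h3, rfl⟩)

theorem aux_comb (m : ℝ≥0 → ℝ≥0 → ℝ) (hs : ∀ a b, m a b = m b a)
    (hm : ∀ a b c, min (m a b) (m b c) ≤ m a c) (s t u v : ℝ≥0) :
    min (m s u + m t v) (m s v + m t u) ≤ m s t + m u v := by
  have a1 := hm s u t
  have a2 := hm s v t
  have a3 := hm u s v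
  have a4 := hm u t v
  have b1 := hm s t u
  have b2 := hm s v u
  have b3 := hm t s v
  have b4 := hm t u v
  have c1 := hm s t v
  have c2 := hm s u v
  have c3 := hm t s u
  have c4 := hm t v u
  rw [hs u t] at *
  rw [hs v t] at *
  rw [hs u s] at *
  rw [hs v u] at *
  rw [hs t s] at *
  generalize m s t = x1 at *
  generalize m s u = x2 at *
  generalize m s v = x3 at *
  generalize m t u = x4 at *
  generalize m t v = x5 at *
  generalize m u v = x6 at *
  clear hm hs
  by_contra hc
  simp only [min_le_iff, not_or, not_le] at *
  grind

/-- If `h : ℝ≥0 → ℝ≥0` is continuous with compact support and `h 0 = 0`,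
then `d_h` satisfies the four-point condition:
`d_h(s,t) + d_h(u,v) ≤ max (d_h(s,u) + d_h(t,v)) (d_h(s,v) + d_h(t,u))`. -/
theorem treeDist_four_point (h : ℝ≥0 → ℝ≥0) (hcont : Continuous h)
    (hsupp : HasCompactSupport h) (h0 : h 0 = 0) :
    ∀ s t u v : ℝ≥0,
      treeDist h s t + treeDist h u v ≤
        max (treeDist h s u + treeDist h t v) (treeDist h s v + treeDist h t u) := by
  intro s t u v
  have := aux_comb (fun a b => sInf ((fun r => (h r : ℝ)) '' Set.Icc (min a b) (max a b)))
    (fun a b => by simp only [min_comm, max_comm]) (fun a b c => aux_min h a b c) s t u v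
  unfold treeDist
  rw [le_max_iff]
  rcases min_le_iff.1 this with h1 | h1
  · left; linarith
  · right; linarith
end

section
/- Let h : ℝ≥0 → ℝ≥0 be continuous with h(0) = 0, and define the kernel c(s,t) = min_{r ∈ [s∧t, s∨t]} h(r) for s,t ≥ 0. Then c is a symmetric positive semidefinite kernel: for every k ∈ ℕ, all points s₁,…,s_k ∈ ℝ≥0 and all reals λ₁,…,λ_k, one has ∑_{i=1}^k ∑_{j=1}^k λ_i λ_j c(s_i, s_j) ≥ 0. -/
open scoped NNReal

/-- The kernel `c(s,t) = min_{r ∈ [s ∧ t, s ∨ t]} h(r)`, expressed as the infimum of the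
image of the compact interval (which is attained since `h` is continuous). -/
noncomputable def minKernel (h : ℝ≥0 → ℝ≥0) (s t : ℝ≥0) : ℝ :=
  sInf ((fun r => (h r : ℝ)) '' Set.Icc (min s t) (max s t))

theorem le_minKernel_iff (h : ℝ≥0 → ℝ≥0) (s t : ℝ≥0) (u : ℝ) :
    u ≤ minKernel h s t ↔ ∀ r ∈ Set.uIcc s t, u ≤ (h r : ℝ) := by
  unfold minKernel
  rw [le_csInf_iff]
  · simp only [Set.forall_mem_image]
    rfl
  · exact ⟨0, by rintro _ ⟨r, _, rfl⟩; exact (h r).2⟩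
  · exact Set.Nonempty.image _ ⟨min s t, le_refl _, min_le_max⟩

theorem per_sum_nonneg {k : ℕ} (R : Fin k → Fin k → Prop) (hs : ∀ i j, R i j → R j i)
    (ht : ∀ i j l, R i j → R j l → R i l) (lam : Fin k → ℝ) :
    0 ≤ ∑ i, ∑ j, lam i * lam j * (open Classical in if R i j then (1:ℝ) else 0) := by
  classical
  let v : Set (Fin k) → Fin k → ℝ := fun A i => if R i i ∧ {j | R i j} = A then 1 else 0
  have key : ∀ i j, (if R i j then (1:ℝ) else 0) = ∑ A, v A i * v A j := by
    intro i j
    rw [Finset.sum_eq_single {l | R i l}]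
    · by_cases hij : R i j
      · have hii := ht _ _ _ hij (hs _ _ hij)
        have hjj := ht _ _ _ (hs _ _ hij) hij
        have : {l | R j l} = {l | R i l} := by
          ext l
          exact ⟨fun a => ht _ _ _ hij a, fun a => ht _ _ _ (hs _ _ hij) a⟩
        simp [v, hij, hii, hjj, this]
      · have : ¬ (R j j ∧ {l | R j l} = {l | R i l}) := by
          rintro ⟨a, b⟩
          have : j ∈ {l | R j l} := a
          rw [b] at this
          exact hij this
        simp only [v, if_neg hij, if_neg this, mul_zero]
    · intro A _ hA
      have : ¬ (R i i ∧ {l | R i l} = A) := fun a => hA a.2.symm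
      simp only [v, if_neg this, zero_mul]
    · simp
  have : ∑ i, ∑ j, lam i * lam j * (if R i j then (1:ℝ) else 0)
      = ∑ A, (∑ i, lam i * v A i) ^ 2 := by
    simp_rw [key, Finset.mul_sum, sq, Finset.sum_mul_sum]
    rw [Finset.sum_comm' (t' := Finset.univ) (s' := fun _ => Finset.univ) (by simp)]
    rw [Finset.sum_comm]
    simp_rw [fun i => Finset.sum_comm (s := (Finset.univ : Finset (Fin k)))
      (t := (Finset.univ : Finset (Set (Fin k)))) (f := fun j A => lam i * lam j * (v A i * v A j))]
    rw [Finset.sum_comm]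
    refine Finset.sum_congr rfl fun A _ => Finset.sum_congr rfl fun i _ =>
      Finset.sum_congr rfl fun j _ => by ring
  rw [this]
  positivity

theorem integral_layer (c : ℝ) (hc : 0 ≤ c) :
    c = ∫ u : ℝ, (Set.Ioc 0 c).indicator (fun _ => (1:ℝ)) u := by
  rw [MeasureTheory.integral_indicator measurableSet_Ioc]
  simp [hc]

/-- If `h : ℝ≥0 → ℝ≥0` is continuous with `h 0 = 0`, then the kernel
`c(s,t) = min_{r ∈ [s ∧ t, s ∨ t]} h(r)` is a symmetric positive semidefinite kernel:
for all points `s₁, …, s_k` and reals `λ₁, …, λ_k`, `∑ᵢ∑ⱼ λᵢ λⱼ c(sᵢ, sⱼ) ≥ 0`. -/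
theorem minKernel_posSemidef (h : ℝ≥0 → ℝ≥0) (hcont : Continuous h) (h0 : h 0 = 0) :
    (∀ s t, minKernel h s t = minKernel h t s) ∧
    ∀ (k : ℕ) (s : Fin k → ℝ≥0) (lam : Fin k → ℝ),
      0 ≤ ∑ i, ∑ j, lam i * lam j * minKernel h (s i) (s j) := by
  classical
  refine ⟨fun s t => by simp only [minKernel, min_comm, max_comm], fun k s lam => ?_⟩
  have hint : ∀ i j, MeasureTheory.Integrable (fun u : ℝ => lam i * lam j *
      (Set.Ioc 0 (minKernel h (s i) (s j))).indicator (fun _ => (1:ℝ)) u) := by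
    intro i j
    refine MeasureTheory.Integrable.const_mul ?_ _
    rw [MeasureTheory.integrable_indicator_iff measurableSet_Ioc]
    simp
  have e : ∑ i, ∑ j, lam i * lam j * minKernel h (s i) (s j) =
      ∫ u : ℝ, ∑ i, ∑ j, lam i * lam j *
        (Set.Ioc 0 (minKernel h (s i) (s j))).indicator (fun _ => (1:ℝ)) u := by
    rw [MeasureTheory.integral_finsetSum _
      (fun i _ => MeasureTheory.integrable_finsetSum _ (fun j _ => hint i j))]
    refine Finset.sum_congr rfl fun i _ => ?_
    rw [MeasureTheory.integral_finsetSum _ (fun j _ => hint i j)]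
    refine Finset.sum_congr rfl fun j _ => ?_
    rw [MeasureTheory.integral_const_mul, ← integral_layer]
    exact (le_minKernel_iff _ _ _ _).2 fun r _ => (h r).2
  rw [e]
  refine MeasureTheory.integral_nonneg fun u => ?_
  have := per_sum_nonneg (fun i j => u ∈ Set.Ioc 0 (minKernel h (s i) (s j))) ?_ ?_ lam
  · refine le_of_le_of_eq this ?_
    refine Finset.sum_congr rfl fun i _ => Finset.sum_congr rfl fun j _ => ?_
    rw [Set.indicator_apply]
    congr
  · rintro i j ⟨a, b⟩
    refine ⟨a, ?_⟩
    rw [le_minKernel_iff] at b ⊢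
    rwa [Set.uIcc_comm]
  · rintro i j l ⟨a, b⟩ ⟨_, b'⟩
    refine ⟨a, ?_⟩
    rw [le_minKernel_iff] at b b' ⊢
    intro r hr
    rcases Set.uIcc_subset_uIcc_union_uIcc (b := s j) hr with h1 | h1
    · exact b r h1
    · exact b' r h1
end

section
/- Let h : ℝ≥0 → ℝ≥0 be continuous with compact support and h(0) = 0, and assume h is Hölder continuous: there exist δ ∈ (0,1] and C > 0 with |h(s) − h(s')| ≤ C|s − s'|^δ for all s, s' ≥ 0. Then there exist a probability space (Ω, 𝔉, P) and a stochastic process (X_s)_{s≥0}, X_s : Ω → ℝ, such that: (i) for every ω ∈ Ω the sample path s ↦ X_s(ω) is continuous; (ii) for every k ∈ ℕ, all s₁,…,s_k ∈ ℝ≥0 and all reals λ₁,…,λ_k, the random variable ∑_{i=1}^k λ_i X_{s_i} is a centered Gaussian random variable with variance ∑_{i,j} λ_i λ_j c(s_i, s_j), where c(s,t) = min_{r ∈ [s∧t, s∨t]} h(r). In particular X_0 = 0 almost surely and E[X_s X_t] = c(s,t). -/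
open scoped NNReal
open MeasureTheory

open ProbabilityTheory in
theorem charFun_lip {Ω : Type*} [MeasurableSpace Ω] (P : Measure Ω) [IsProbabilityMeasure P]
    (Y Z : Lp ℝ 2 P) (t : ℝ) :
    ‖charFun (P.map Y) t - charFun (P.map Z) t‖ ≤ |t| * ‖Y - Z‖ := by
  have hm : ∀ Y : Lp ℝ 2 P, charFun (P.map Y) t = ∫ ω, Complex.exp (t * Y ω * Complex.I) ∂P := by
    intro Y
    rw [charFun_apply_real, integral_map (Lp.aestronglyMeasurable Y).aemeasurable]
    exact Measurable.aestronglyMeasurable (by fun_prop)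
  have hi : ∀ Y : Lp ℝ 2 P, Integrable (fun ω => Complex.exp (t * Y ω * Complex.I)) P := by
    intro Y
    refine Integrable.of_bound (C := 1) ?_ (Filter.Eventually.of_forall fun ω => ?_)
    · have := (Lp.stronglyMeasurable Y).measurable
      exact Measurable.aestronglyMeasurable (by fun_prop)
    · rw [← Complex.ofReal_mul, Complex.norm_exp_ofReal_mul_I]
  rw [hm, hm, ← integral_sub (hi Y) (hi Z)]
  have hint : Integrable (fun ω => |(Y - Z) ω|) P :=
    ((Lp.memLp (Y - Z)).integrable (by norm_num)).abs
  calc _ ≤ ∫ ω, ‖Complex.exp (t * Y ω * Complex.I) - Complex.exp (t * Z ω * Complex.I)‖ ∂P :=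
        norm_integral_le_integral_norm _
    _ ≤ ∫ ω, |t| * |(Y - Z) ω| ∂P := by
        refine integral_mono_ae ((hi Y).sub (hi Z)).norm (hint.const_mul _) ?_
        filter_upwards [Lp.coeFn_sub Y Z] with ω hω
        rw [hω, Pi.sub_apply, ← abs_mul, mul_sub]
        have : Complex.exp (t * Y ω * Complex.I) - Complex.exp (t * Z ω * Complex.I)
            = Complex.exp (((t * Z ω : ℝ) : ℂ) * Complex.I) *
              (Complex.exp (Complex.I * ((t * Y ω - t * Z ω : ℝ) : ℂ)) - 1) := by
          rw [mul_sub, ← Complex.exp_add]; push_cast; ring_nf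
        simp only [this, norm_mul, Complex.norm_exp_ofReal_mul_I, one_mul]
        exact Real.norm_exp_I_mul_ofReal_sub_one_le
    _ = |t| * ∫ ω, |(Y - Z) ω| ∂P := integral_const_mul _ _
    _ ≤ |t| * ‖Y - Z‖ := by
        gcongr
        rw [Lp.norm_def]
        have h1 : ∫ ω, |(Y - Z) ω| ∂P = (eLpNorm (Y - Z : Lp ℝ 2 P) 1 P).toReal := by
          rw [eLpNorm_one_eq_lintegral_enorm, ← integral_norm_eq_lintegral_enorm (Lp.aestronglyMeasurable _)]
          rfl
        rw [h1]
        refine ENNReal.toReal_mono (Lp.memLp _).2.ne ?_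
        exact eLpNorm_le_eLpNorm_of_exponent_le (by norm_num) (Lp.aestronglyMeasurable _)

open ProbabilityTheory in
theorem exists_isonormal (H : Type) [NormedAddCommGroup H] [InnerProductSpace ℝ H]
    [CompleteSpace H] :
    ∃ (Ω : Type) (_ : MeasurableSpace Ω) (P : Measure Ω) (_ : IsProbabilityMeasure P)
      (W : H →ₗᵢ[ℝ] Lp ℝ 2 P), ∀ f, P.map (W f) = gaussianReal 0 (‖f‖₊ ^ 2) := by
  obtain ⟨ι, b, hb⟩ := exists_hilbertBasis ℝ H
  let P : Measure (ι → ℝ) := Measure.infinitePi (fun _ => gaussianReal 0 1)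
  have hlaw : ∀ i, HasLaw (fun ω : ι → ℝ => ω i) (gaussianReal 0 1) P := fun i =>
    (measurePreserving_eval_infinitePi (fun _ : ι => gaussianReal 0 1) i).hasLaw
  have hG : ∀ i, HasGaussianLaw (fun ω : ι → ℝ => ω i) P := fun i => (hlaw i).hasGaussianLaw
  have hind : iIndepFun (fun (i : ι) (ω : ι → ℝ) => ω i) P :=
    iIndepFun_infinitePi (X := fun _ x => x) (fun _ => measurable_id)
  have hmean : ∀ i, ∫ ω : ι → ℝ, ω i ∂P = 0 := fun i => by
    rw [(hlaw i).integral_eq, integral_id_gaussianReal]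
  have hvar : ∀ i, ∫ ω : ι → ℝ, ω i * ω i ∂P = 1 := fun i => by
    have h1 := (hlaw i).variance_eq
    rw [variance_id_gaussianReal, variance_of_integral_eq_zero (hG i).aemeasurable (hmean i)] at h1
    simpa [sq] using h1
  let ξ : ι → Lp ℝ 2 P := fun i => (hG i).memLp_two.toLp
  have hξ : Orthonormal ℝ ξ := by
    classical
    rw [orthonormal_iff_ite]
    intro i j
    rw [L2.inner_def]
    have : ∫ ω, inner ℝ (ξ i ω) (ξ j ω) ∂P = ∫ ω : ι → ℝ, ω i * ω j ∂P := by
      refine integral_congr_ae ?_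
      filter_upwards [(hG i).memLp_two.coeFn_toLp, (hG j).memLp_two.coeFn_toLp] with ω h1 h2
      simp only [ξ, h1, h2]
      simp [mul_comm]
    rw [this]
    split_ifs with hij
    · subst hij; exact hvar i
    · have := (hind.indepFun hij).integral_mul_eq_mul_integral
        (hG i).aemeasurable.aestronglyMeasurable (hG j).aemeasurable.aestronglyMeasurable
      simpa [hmean] using this
  let W : H →ₗᵢ[ℝ] Lp ℝ 2 P :=
    hξ.orthogonalFamily.linearIsometry.comp b.repr.toLinearIsometry
  have hWb : ∀ i, W (b i) = ξ i := by
    classical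
    intro i
    have h1 : W (b i) = hξ.orthogonalFamily.linearIsometry (b.repr (b i)) := rfl
    rw [h1, b.repr_self]
    exact (OrthogonalFamily.linearIsometry_apply_single _ _).trans (by simp)
  refine ⟨ι → ℝ, inferInstance, P, inferInstance, W, ?_⟩
  have key : ∀ f t, charFun (P.map (W f)) t = Complex.exp (-(‖f‖ ^ 2 * t ^ 2 / 2)) := by
    intro f t
    have hd : Dense (Submodule.span ℝ (Set.range b) : Set H) := by
      rw [Submodule.dense_iff_topologicalClosure_eq_top]
      exact b.dense_span
    have hc : Continuous fun f => charFun (P.map (W f)) t := by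
      refine (LipschitzWith.of_dist_le_mul (K := |t|.toNNReal) fun x y => ?_).continuous
      rw [dist_eq_norm, dist_eq_norm, Real.coe_toNNReal _ (abs_nonneg t), ← W.norm_map (x - y),
        map_sub]
      exact charFun_lip P _ _ t
    have := hc.ext_on (g := fun f : H => Complex.exp (-(‖f‖ ^ 2 * t ^ 2 / 2))) hd (by fun_prop) ?_
    · exact congrFun this f
    intro x hx
    obtain ⟨c, rfl⟩ := Finsupp.mem_span_range_iff_exists_finsupp.1 hx
    set x := c.sum fun i a => a • b i with hxdef
    have hWx : (W x : (ι → ℝ) → ℝ) =ᵐ[P] fun ω => ∑ i : c.support, c i * ω i := by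
      have h1 : W x = ∑ i ∈ c.support, c i • ξ i := by
        simp [hxdef, Finsupp.sum, hWb]
      have h2 : ∀ s : Finset ι, ((∑ i ∈ s, c i • ξ i : Lp ℝ 2 P) : (ι → ℝ) → ℝ) =ᵐ[P]
          fun ω => ∑ i ∈ s, c i * ω i := by
        classical
        intro s
        induction s using Finset.induction_on with
        | empty => simp only [Finset.sum_empty]; exact Lp.coeFn_zero ℝ 2 P
        | insert a s ha ih =>
          rw [Finset.sum_insert ha]
          filter_upwards [Lp.coeFn_add (c a • ξ a) (∑ i ∈ s, c i • ξ i), ih,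
            Lp.coeFn_smul (c a) (ξ a), (hG a).memLp_two.coeFn_toLp] with ω e1 e2 e3 e4
          rw [e1, Pi.add_apply, e2, e3, Finset.sum_insert ha, Pi.smul_apply, e4]
          rfl
      rw [h1]
      filter_upwards [h2 c.support] with ω hω
      rw [hω, Finset.sum_coe_sort c.support (fun i => c i * ω i)]
    have hg : HasGaussianLaw (fun ω : ι → ℝ => ∑ i : c.support, c i * ω i) P := by
      have h1 : HasGaussianLaw (fun (ω : ι → ℝ) (i : c.support) => ω i) P :=
        iIndepFun.hasGaussianLaw (X := fun (i : c.support) (ω : ι → ℝ) => ω i)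
          (fun i => hG i) (hind.precomp Subtype.val_injective)
      have h2 := h1.map (∑ i : c.support, c i • ContinuousLinearMap.proj (R := ℝ) (φ := fun _ => ℝ) i)
      refine h2.congr (Filter.Eventually.of_forall fun ω => ?_)
      simp
    have hg' : HasGaussianLaw (W x) P := hg.congr hWx.symm
    have hm0 : ∫ ω, W x ω ∂P = 0 := by
      rw [integral_congr_ae hWx, integral_finsetSum]
      · simp [integral_const_mul, hmean]
      · intro i _
        exact (hG i).integrable.const_mul _
    have hv : Var[W x; P] = ‖x‖ ^ 2 := by
      rw [variance_of_integral_eq_zero hg'.aemeasurable hm0, ← W.norm_map x,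
        ← real_inner_self_eq_norm_sq, L2.inner_def]
      simp [sq]
    show charFun (P.map (W x)) t = _
    rw [hg'.map_eq_gaussianReal, hm0, hv, charFun_gaussianReal]
    rw [Real.coe_toNNReal _ (sq_nonneg _)]
    congr 1
    push_cast; ring
  intro f
  have : IsProbabilityMeasure (P.map (W f)) :=
    Measure.isProbabilityMeasure_map (Lp.aestronglyMeasurable _).aemeasurable
  refine Measure.ext_of_charFun ?_
  ext t
  rw [key, charFun_gaussianReal]
  congr 1
  push_cast; ring


theorem lt_minKernel_iff {h : ℝ≥0 → ℝ≥0} (hcont : Continuous h) (s t : ℝ≥0) (x : ℝ) :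
    x < minKernel h s t ↔ ∀ r ∈ Set.uIcc s t, x < h r := by
  have hc : Continuous fun r => (h r : ℝ) := by fun_prop
  have hcomp : IsCompact ((fun r => (h r : ℝ)) '' Set.uIcc s t) := isCompact_uIcc.image hc
  constructor
  · intro hx r hr
    exact hx.trans_le (csInf_le hcomp.bddBelow ⟨r, hr, rfl⟩)
  · intro hx
    obtain ⟨r, hr, he⟩ := hcomp.sInf_mem (Set.nonempty_uIcc.image _)
    have := hx r hr
    unfold minKernel
    change x < sInf ((fun r => (h r : ℝ)) '' Set.uIcc s t)
    rw [← he]; exact this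

theorem minKernel_comm (h : ℝ≥0 → ℝ≥0) (s t : ℝ≥0) : minKernel h s t = minKernel h t s := by
  simp [minKernel, min_comm, max_comm]

theorem minKernel_self (h : ℝ≥0 → ℝ≥0) (s : ℝ≥0) : minKernel h s s = h s := by
  simp [minKernel]

theorem minKernel_nonneg (h : ℝ≥0 → ℝ≥0) (s t : ℝ≥0) : 0 ≤ minKernel h s t := by
  refine Real.sInf_nonneg ?_
  rintro _ ⟨r, _, rfl⟩
  exact (h r).coe_nonneg

theorem lt_minKernel_trans {h : ℝ≥0 → ℝ≥0} (hcont : Continuous h) {s t u : ℝ≥0} {x : ℝ}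
    (h1 : x < minKernel h s u) (h2 : x < minKernel h u t) : x < minKernel h s t := by
  rw [lt_minKernel_iff hcont] at *
  intro r hr
  rcases Set.uIcc_subset_uIcc_union_uIcc (b := u) hr with hr | hr
  · exact h1 r hr
  · exact h2 r hr

theorem exists_denseSeq_lt {h : ℝ≥0 → ℝ≥0} (hcont : Continuous h) {s : ℝ≥0} {x : ℝ}
    (hx : x < h s) : ∃ n, x < minKernel h s (TopologicalSpace.denseSeq ℝ≥0 n) := by
  have hU : {r | x < (h r : ℝ)} ∈ nhds s := by
    have hc : Continuous fun r => (h r : ℝ) := by fun_prop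
    exact (isOpen_lt continuous_const hc).mem_nhds hx
  have ht : Filter.Tendsto (fun q => Set.uIcc s q) (nhds s) (nhds s).smallSets :=
    (tendsto_const_nhds (x := s)).uIcc Filter.tendsto_id
  have he := ht.eventually (Filter.eventually_smallSets_subset.2 hU)
  obtain ⟨q, ⟨n, rfl⟩, hq⟩ := (TopologicalSpace.denseRange_denseSeq ℝ≥0).inter_nhds_nonempty he
  exact ⟨n, (lt_minKernel_iff hcont _ _ _).2 fun r hr => hq hr⟩

/-- Sets realising the kernel as measures of intersections. -/
def ancSet (h : ℝ≥0 → ℝ≥0) (s : ℝ≥0) : Set (ℝ × ℕ) :=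
  {p | 0 ≤ p.1 ∧ p.1 < minKernel h s (TopologicalSpace.denseSeq ℝ≥0 p.2) ∧
    ∀ m < p.2, ¬ p.1 < minKernel h s (TopologicalSpace.denseSeq ℝ≥0 m)}

theorem measurableSet_ancSet (h : ℝ≥0 → ℝ≥0) (s : ℝ≥0) : MeasurableSet (ancSet h s) := by
  have : ancSet h s = ⋃ n : ℕ, {x : ℝ | 0 ≤ x ∧ x < minKernel h s (TopologicalSpace.denseSeq ℝ≥0 n) ∧
    ∀ m < n, ¬ x < minKernel h s (TopologicalSpace.denseSeq ℝ≥0 m)} ×ˢ {n} := by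
    ext ⟨x, n⟩
    simp [ancSet]
  rw [this]
  refine MeasurableSet.iUnion fun n => MeasurableSet.prod ?_ (MeasurableSet.singleton n)
  refine (measurableSet_Ici (a := (0:ℝ))).inter (MeasurableSet.inter measurableSet_Iio ?_)
  have : {x : ℝ | ∀ m < n, ¬ x < minKernel h s (TopologicalSpace.denseSeq ℝ≥0 m)}
    = ⋂ m, ⋂ (_ : m < n), (Set.Iio (minKernel h s (TopologicalSpace.denseSeq ℝ≥0 m)))ᶜ := by
    ext x; simp
  change MeasurableSet {x : ℝ | ∀ m < n, ¬ x < minKernel h s (TopologicalSpace.denseSeq ℝ≥0 m)}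
  rw [this]
  exact MeasurableSet.iInter fun m => MeasurableSet.iInter fun _ => measurableSet_Iio.compl

theorem measure_ancSet_inter {h : ℝ≥0 → ℝ≥0} (hcont : Continuous h) (s t : ℝ≥0) :
    ((volume : Measure ℝ).prod (Measure.count : Measure ℕ)) (ancSet h s ∩ ancSet h t) =
      ENNReal.ofReal (minKernel h s t) := by
  rw [Measure.prod_apply ((measurableSet_ancSet h s).inter (measurableSet_ancSet h t))]
  have : ∀ x : ℝ, (Measure.count : Measure ℕ) (Prod.mk x ⁻¹' (ancSet h s ∩ ancSet h t)) =
      (Set.Ico 0 (minKernel h s t)).indicator (fun _ => 1) x := by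
    intro x
    by_cases hx : x ∈ Set.Ico 0 (minKernel h s t)
    · rw [Set.indicator_of_mem hx]
      have hs : x < h s := (lt_minKernel_iff hcont _ _ _).1 hx.2 s Set.left_mem_uIcc
      have hex := exists_denseSeq_lt hcont hs
      classical
      have : Prod.mk x ⁻¹' (ancSet h s ∩ ancSet h t) = {Nat.find hex} := by
        have hiff : ∀ u, x < minKernel h t u ↔ x < minKernel h s u := fun u =>
          ⟨fun hh => lt_minKernel_trans hcont hx.2 hh,
           fun hh => lt_minKernel_trans hcont (minKernel_comm h s t ▸ hx.2) hh⟩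
        ext n
        simp only [ancSet, Set.mem_preimage, Set.mem_inter_iff, Set.mem_ofPred_eq, hiff, and_self,
          Set.mem_singleton_iff]
        rw [eq_comm, Nat.find_eq_iff]
        exact ⟨fun hh => hh.2, fun hh => ⟨hx.1, hh⟩⟩
      rw [this, Measure.count_singleton]
    · rw [Set.indicator_of_notMem hx]
      have : Prod.mk x ⁻¹' (ancSet h s ∩ ancSet h t) = ∅ := by
        ext n
        simp only [Set.mem_preimage, Set.mem_inter_iff, Set.mem_empty_iff_false, iff_false]
        rintro ⟨h1, h2⟩
        exact hx ⟨h1.1, lt_minKernel_trans hcont h1.2.1 (minKernel_comm h t _ ▸ h2.2.1)⟩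
      rw [this, measure_empty]
  simp_rw [this]
  rw [lintegral_indicator measurableSet_Ico]
  simp

theorem exists_feature {h : ℝ≥0 → ℝ≥0} (hcont : Continuous h) :
    ∃ φ : ℝ≥0 → Lp ℝ 2 ((volume : Measure ℝ).prod (Measure.count : Measure ℕ)),
      ∀ s t, inner ℝ (φ s) (φ t) = minKernel h s t := by
  have hfin : ∀ s, ((volume : Measure ℝ).prod (Measure.count : Measure ℕ)) (ancSet h s) ≠ ⊤ := by
    intro s
    have := measure_ancSet_inter hcont s s
    rw [Set.inter_self] at this
    rw [this]; exact ENNReal.ofReal_ne_top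
  refine ⟨fun s => indicatorConstLp 2 (measurableSet_ancSet h s) (hfin s) 1, fun s t => ?_⟩
  rw [L2.real_inner_indicatorConstLp_one_indicatorConstLp_one _ _ (hfin s) (hfin t), Measure.real,
    measure_ancSet_inter hcont, ENNReal.toReal_ofReal (minKernel_nonneg h s t)]

theorem minKernel_incr {h : ℝ≥0 → ℝ≥0} (hcont : Continuous h) {δ C : ℝ} (hδ0 : 0 < δ) (hC : 0 < C)
    (hHolder : ∀ s t : ℝ≥0, |(h s : ℝ) - (h t : ℝ)| ≤ C * |(s : ℝ) - (t : ℝ)| ^ δ) (s t : ℝ≥0) :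
    h s + h t - 2 * minKernel h s t ≤ 2 * C * |(s : ℝ) - t| ^ δ := by
  have hc : Continuous fun r => (h r : ℝ) := by fun_prop
  have hcomp : IsCompact ((fun r => (h r : ℝ)) '' Set.uIcc s t) := isCompact_uIcc.image hc
  obtain ⟨r, hr, he⟩ := hcomp.sInf_mem (Set.nonempty_uIcc.image _)
  change _ = minKernel h s t at he
  rw [← he]
  have hr' : (r : ℝ) ∈ Set.uIcc (s : ℝ) t := by
    rw [Set.mem_uIcc] at hr ⊢; exact_mod_cast hr
  have h1 := le_trans (le_abs_self _) (hHolder s r)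
  have h2 := le_trans (le_abs_self _) (hHolder t r)
  have a1 : |(s : ℝ) - r| ≤ |(s:ℝ) - t| := by
    rw [abs_sub_comm, abs_sub_comm (s:ℝ)]; exact Set.abs_sub_left_of_mem_uIcc hr'
  have a2 : |(t : ℝ) - r| ≤ |(s:ℝ) - t| := by
    rw [abs_sub_comm (s:ℝ)]; exact Set.abs_sub_right_of_mem_uIcc hr'
  have b1 : C * |(s : ℝ) - r| ^ δ ≤ C * |(s:ℝ) - t| ^ δ := by gcongr
  have b2 : C * |(t : ℝ) - r| ^ δ ≤ C * |(s:ℝ) - t| ^ δ := by gcongr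
  simp only
  linarith


/-- Tent function. -/
noncomputable def tent (x : ℝ) : ℝ := max 0 (1 - |x|)

theorem continuous_tent : Continuous tent := by unfold tent; fun_prop

/-- Dyadic piecewise linear interpolation. -/
noncomputable def interp (y : ℝ≥0 → ℝ) (T n : ℕ) (t : ℝ≥0) : ℝ :=
  ∑ k ∈ Finset.range (T * 2 ^ n), y (k / 2 ^ n) * tent (2 ^ n * t - k)

theorem continuous_interp (y : ℝ≥0 → ℝ) (T n : ℕ) : Continuous (interp y T n) := by
  unfold interp
  have := continuous_tent
  fun_prop

theorem interp_eq {y : ℝ≥0 → ℝ} {T : ℕ} (hy : ∀ s : ℝ≥0, (T : ℝ≥0) ≤ s → y s = 0) (n : ℕ)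
    (t : ℝ≥0) :
    interp y T n t = y (⌊2 ^ n * (t : ℝ)⌋₊ / 2 ^ n) * (1 - (2 ^ n * (t:ℝ) - ⌊2 ^ n * (t : ℝ)⌋₊)) +
      y ((⌊2 ^ n * (t : ℝ)⌋₊ + 1 : ℕ) / 2 ^ n) * (2 ^ n * (t:ℝ) - ⌊2 ^ n * (t : ℝ)⌋₊) := by
  set u : ℝ := 2 ^ n * (t : ℝ) with hu
  have hu0 : 0 ≤ u := by positivity
  set k := ⌊u⌋₊ with hk
  have h1 : (k : ℝ) ≤ u := Nat.floor_le hu0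
  have h2 : u < k + 1 := Nat.lt_floor_add_one u
  have hz : ∀ j : ℕ, T * 2 ^ n ≤ j → y (j / 2 ^ n) = 0 := by
    intro j hj
    refine hy _ ?_
    rw [le_div_iff₀ (by positivity)]
    exact_mod_cast hj
  have ht : ∀ j : ℕ, j ≠ k → j ≠ k + 1 → tent (u - j) = 0 := by
    intro j hj1 hj2
    unfold tent
    refine max_eq_left ?_
    rcases lt_or_gt_of_ne hj1 with hlt | hlt
    · have : (j : ℝ) + 1 ≤ k := by exact_mod_cast hlt
      have := le_abs_self (u - j)
      linarith
    · have : (k : ℝ) + 1 + 1 ≤ j := by exact_mod_cast (by omega : k + 1 + 1 ≤ j)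
      have := neg_le_abs (u - j)
      linarith
  have e1 : interp y T n t = ∑ j ∈ Finset.range (T * 2 ^ n + (k + 2)), y (j / 2 ^ n) * tent (u - j) := by
    unfold interp
    refine Finset.sum_subset (Finset.range_subset_range.2 (by omega)) ?_
    intro j _ hj
    rw [hz j (by simpa using hj), zero_mul]
  have e2 : ∑ j ∈ ({k, k + 1} : Finset ℕ), y (j / 2 ^ n) * tent (u - j) =
      ∑ j ∈ Finset.range (T * 2 ^ n + (k + 2)), y (j / 2 ^ n) * tent (u - j) := by
    refine Finset.sum_subset ?_ ?_
    · intro j hj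
      simp only [Finset.mem_insert, Finset.mem_singleton] at hj
      rw [Finset.mem_range]; omega
    · intro j _ hj
      simp only [Finset.mem_insert, Finset.mem_singleton, not_or] at hj
      rw [ht j hj.1 hj.2, mul_zero]
  rw [e1, ← e2, Finset.sum_pair (by omega)]
  have t1 : tent (u - k) = 1 - (u - k) := by
    unfold tent
    rw [abs_of_nonneg (by linarith), max_eq_right (by linarith)]
  have t2 : tent (u - (k + 1 : ℕ)) = u - k := by
    unfold tent
    push_cast
    rw [abs_of_nonpos (by linarith), max_eq_right (by linarith)]
    ring
  rw [t1, t2]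

theorem interp_sub_le {y : ℝ≥0 → ℝ} {T : ℕ} (hy : ∀ s : ℝ≥0, (T : ℝ≥0) ≤ s → y s = 0) (n : ℕ)
    {D : ℝ} (hD : ∀ k : ℕ, |y ((k + 1 : ℕ) / 2 ^ n) - y (k / 2 ^ n)| ≤ D) (t : ℝ≥0) :
    |interp y T n t - y (⌊2 ^ n * (t : ℝ)⌋₊ / 2 ^ n)| ≤ D := by
  rw [interp_eq hy]
  have hu0 : 0 ≤ 2 ^ n * (t : ℝ) := by positivity
  have h1 := Nat.floor_le hu0
  have h2 := Nat.lt_floor_add_one (2 ^ n * (t : ℝ))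
  have hk := hD ⌊2 ^ n * (t : ℝ)⌋₊
  set k := ⌊2 ^ n * (t : ℝ)⌋₊
  set u : ℝ := 2 ^ n * (t : ℝ)
  have : y (k / 2 ^ n) * (1 - (u - k)) + y ((k + 1 : ℕ) / 2 ^ n) * (u - k) - y (k / 2 ^ n) =
    (y ((k + 1 : ℕ) / 2 ^ n) - y (k / 2 ^ n)) * (u - k) := by ring
  rw [this, abs_mul, abs_of_nonneg (by linarith : 0 ≤ u - k)]
  calc _ ≤ |y ((k + 1 : ℕ) / 2 ^ n) - y (k / 2 ^ n)| * 1 := by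
        gcongr; linarith
    _ ≤ D := by linarith

theorem interp_step_le {y : ℝ≥0 → ℝ} {T : ℕ} (hy : ∀ s : ℝ≥0, (T : ℝ≥0) ≤ s → y s = 0)
    {B r : ℝ} (hB : 0 ≤ B) (hr0 : 0 ≤ r) (hr1 : r ≤ 1)
    (hD : ∀ n k : ℕ, |y ((k + 1 : ℕ) / 2 ^ n) - y (k / 2 ^ n)| ≤ B * r ^ n) (n : ℕ) (t : ℝ≥0) :
    dist (interp y T n t) (interp y T (n + 1) t) ≤ 3 * B * r ^ n := by
  have a1 := interp_sub_le hy n (hD n) t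
  have a2 := interp_sub_le hy (n + 1) (hD (n + 1)) t
  have hr : B * r ^ (n + 1) ≤ B * r ^ n := by
    rw [pow_succ]
    have : B * r ^ n * r ≤ B * r ^ n * 1 := by gcongr
    linarith
  have hu0 : 0 ≤ 2 ^ n * (t : ℝ) := by positivity
  have hu1 : 0 ≤ 2 ^ (n + 1) * (t : ℝ) := by positivity
  have f1 := Nat.floor_le hu0
  have f2 := Nat.lt_floor_add_one (2 ^ n * (t : ℝ))
  have f3 := Nat.floor_le hu1
  have f4 := Nat.lt_floor_add_one (2 ^ (n + 1) * (t : ℝ))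
  set k := ⌊2 ^ n * (t : ℝ)⌋₊
  set l := ⌊2 ^ (n + 1) * (t : ℝ)⌋₊
  have hl : l = 2 * k ∨ l = 2 * k + 1 := by
    rw [pow_succ] at f3 f4
    have g1 : (2 * k : ℝ) < l + 1 := by linarith
    have g2 : (l : ℝ) < 2 * k + 2 := by linarith
    have g1' : 2 * k < l + 1 := by exact_mod_cast g1
    have g2' : l < 2 * k + 2 := by exact_mod_cast g2
    omega
  have he : ((2 * k : ℕ) : ℝ≥0) / 2 ^ (n + 1) = k / 2 ^ n := by
    rw [pow_succ]; push_cast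
    field_simp
  have a3 : |y (l / 2 ^ (n + 1)) - y (k / 2 ^ n)| ≤ B * r ^ (n + 1) := by
    rcases hl with hl | hl
    · rw [hl, he, sub_self, abs_zero]; positivity
    · have := hD (n + 1) (2 * k)
      rwa [he, ← hl] at this
  rw [Real.dist_eq]
  rw [abs_le] at *
  constructor <;> linarith [a1.1, a1.2, a2.1, a2.2, a3.1, a3.2]

theorem abs_le_of_pow_bound {p : ℕ} (hp : p ≠ 0) {S : ENNReal} (hS : S ≠ ⊤) {x : ℝ} {n : ℕ}
    (hx : 2 ^ n * ‖x‖ₑ ^ p ≤ S) :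
    |x| ≤ max 1 S.toReal * (((1 / 2 : ℝ) ^ (1 / (p : ℝ)))) ^ n := by
  set r : ℝ := (1 / 2 : ℝ) ^ (1 / (p : ℝ)) with hr
  have hrp : r ^ p = 1 / 2 := by
    rw [hr, ← Real.rpow_natCast, ← Real.rpow_mul (by norm_num)]
    rw [one_div_mul_cancel (by exact_mod_cast hp), Real.rpow_one]
  have hr0 : 0 ≤ r := by positivity
  have h1 : (2:ℝ) ^ n * |x| ^ p ≤ S.toReal := by
    have := ENNReal.toReal_mono hS hx
    simpa using this
  refine le_of_pow_le_pow_left₀ hp (by positivity) ?_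
  rw [mul_pow, ← pow_mul, mul_comm n p, pow_mul, hrp]
  have h2 : S.toReal ≤ max 1 S.toReal ^ p :=
    (le_max_right 1 _).trans (le_self_pow₀ (le_max_left _ _) hp)
  rw [one_div, inv_pow, ← div_eq_mul_inv, le_div_iff₀ (by positivity)]
  linarith

theorem exists_cont_modification {Ω : Type} [MeasurableSpace Ω] (P : Measure Ω)
    (Y : ℝ≥0 → Ω → ℝ) (hYm : ∀ s, Measurable (Y s)) (T : ℕ)
    (hYT : ∀ s : ℝ≥0, (T : ℝ≥0) ≤ s → ∀ ω, Y s ω = 0) (p : ℕ) (hp : p ≠ 0) (K : ENNReal)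
    (hK : K ≠ ⊤)
    (hmom : ∀ (n : ℕ) (s t : ℝ≥0), |(s : ℝ) - t| ≤ (1 / 2) ^ n →
      ∫⁻ ω, ‖Y s ω - Y t ω‖ₑ ^ p ∂P ≤ K * 8⁻¹ ^ n) :
    ∃ X : ℝ≥0 → Ω → ℝ, (∀ s, Measurable (X s)) ∧ (∀ ω, Continuous fun s => X s ω) ∧
      ∀ s, X s =ᵐ[P] Y s := by
  set r : ℝ := (1 / 2 : ℝ) ^ (1 / (p : ℝ)) with hr
  have hr0 : 0 ≤ r := by positivity
  have hr1 : r < 1 := by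
    refine Real.rpow_lt_one (by norm_num) (by norm_num) ?_
    have : (0:ℝ) < p := by exact_mod_cast Nat.pos_of_ne_zero hp
    positivity
  let S : Ω → ENNReal := fun ω => ∑' n : ℕ, ∑ k ∈ Finset.range (T * 2 ^ n),
    2 ^ n * ‖Y ((k + 1 : ℕ) / 2 ^ n) ω - Y (k / 2 ^ n) ω‖ₑ ^ p
  have hSm : Measurable S := by
    refine Measurable.ennreal_tsum fun n => Finset.measurable_sum _ fun k _ => ?_
    exact (((hYm _).sub (hYm _)).enorm.pow_const _).const_mul _
  have hgeo : ∀ c : ENNReal, c ≠ ⊤ → ∑' n : ℕ, c * (2⁻¹ : ENNReal) ^ n ≠ ⊤ := by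
    intro c hc
    rw [ENNReal.tsum_mul_left, ENNReal.tsum_geometric, ENNReal.one_sub_inv_two, inv_inv]
    exact ENNReal.mul_ne_top hc (by norm_num)
  have h28 : (2 : ENNReal) * 2 * 8⁻¹ = 2⁻¹ := by
    rw [show (8 : ENNReal) = 2 * 2 * 2 by norm_num,
      ENNReal.mul_inv (a := 2 * 2) (b := 2) (by norm_num) (by norm_num), ← mul_assoc,
      ENNReal.mul_inv_cancel (by norm_num) (by finiteness), one_mul]
  have hSfin : ∀ᵐ ω ∂P, S ω ≠ ⊤ := by
    have : ∫⁻ ω, S ω ∂P ≠ ⊤ := by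
      rw [lintegral_tsum]
      · refine ne_top_of_le_ne_top (hgeo (T * K) (ENNReal.mul_ne_top (by simp) hK)) ?_
        refine ENNReal.tsum_le_tsum fun n => ?_
        rw [lintegral_finsetSum]
        · calc _ ≤ ∑ k ∈ Finset.range (T * 2 ^ n), (2:ENNReal) ^ n * (K * 8⁻¹ ^ n) := by
                refine Finset.sum_le_sum fun k _ => ?_
                rw [lintegral_const_mul]
                · gcongr
                  refine hmom n _ _ ?_
                  push_cast
                  rw [← sub_div, add_sub_cancel_left, abs_of_nonneg (by positivity), one_div_pow]
                · exact ((hYm _).sub (hYm _)).enorm.pow_const _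
            _ = T * K * (2 * 2 * 8⁻¹) ^ n := by
                simp only [Finset.sum_const, Finset.card_range, nsmul_eq_mul, mul_pow]
                push_cast; ring
            _ = _ := by rw [h28]
        · intro k _
          exact (((hYm _).sub (hYm _)).enorm.pow_const _).const_mul _
      · intro n
        refine (Finset.measurable_sum _ fun k _ => ?_).aemeasurable
        exact (((hYm _).sub (hYm _)).enorm.pow_const _).const_mul _
    exact (ae_lt_top hSm this).mono fun ω h => h.ne
  let G : Set Ω := {ω | S ω ≠ ⊤}
  have hGm : MeasurableSet G := (hSm (measurableSet_singleton ⊤)).compl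
  have hinc : ∀ ω ∈ G, ∀ n k : ℕ, |Y ((k + 1 : ℕ) / 2 ^ n) ω - Y (k / 2 ^ n) ω| ≤
      max 1 (S ω).toReal * r ^ n := by
    intro ω hω n k
    by_cases hk : k < T * 2 ^ n
    · refine abs_le_of_pow_bound hp hω ?_
      refine le_trans ?_ (ENNReal.le_tsum n)
      exact Finset.single_le_sum (f := fun k : ℕ =>
        (2:ENNReal) ^ n * ‖Y ((k + 1 : ℕ) / 2 ^ n) ω - Y (k / 2 ^ n) ω‖ₑ ^ p)
        (fun _ _ => zero_le) (Finset.mem_range.2 hk)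
    · push Not at hk
      have hz : ∀ j : ℕ, T * 2 ^ n ≤ j → Y (j / 2 ^ n) ω = 0 := by
        intro j hj
        refine hYT _ ?_ ω
        rw [le_div_iff₀ (by positivity)]
        exact_mod_cast hj
      rw [hz k hk, hz (k + 1) (by omega), sub_self, abs_zero]
      positivity
  let Z : ℕ → ℝ≥0 → Ω → ℝ := fun n t => G.indicator fun ω => interp (fun s => Y s ω) T n t
  have hZm : ∀ n t, Measurable (Z n t) := by
    intro n t
    refine Measurable.indicator ?_ hGm
    unfold interp
    exact Finset.measurable_sum _ fun k _ => (hYm _).mul_const _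
  have hZc : ∀ n ω, Continuous fun t => Z n t ω := by
    intro n ω
    by_cases hω : ω ∈ G
    · simp only [Z, Set.indicator_of_mem hω]
      exact continuous_interp _ T n
    · simp only [Z, Set.indicator_of_notMem hω]
      exact continuous_const
  have hZs : ∀ ω, ∃ A : ℝ, ∀ n t, dist (Z n t ω) (Z (n + 1) t ω) ≤ A * r ^ n := by
    intro ω
    by_cases hω : ω ∈ G
    · refine ⟨3 * max 1 (S ω).toReal, fun n t => ?_⟩
      simp only [Z, Set.indicator_of_mem hω]
      exact interp_step_le (fun s hs => hYT s hs ω) (by positivity) hr0 hr1.le (hinc ω hω) n t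
    · refine ⟨0, fun n t => ?_⟩
      simp [Z, Set.indicator_of_notMem hω]
  choose A hA using hZs
  have hlim : ∀ t ω, ∃ x, Filter.Tendsto (fun n => Z n t ω) Filter.atTop (nhds x) := fun t ω =>
    cauchySeq_tendsto_of_complete (cauchySeq_of_le_geometric r (A ω) hr1 fun n => hA ω n t)
  choose X hX using hlim
  have hrt : Filter.Tendsto (fun n => r ^ n) Filter.atTop (nhds 0) :=
    tendsto_pow_atTop_nhds_zero_of_lt_one hr0 hr1
  refine ⟨X, fun t => ?_, fun ω => ?_, fun t => ?_⟩
  · exact measurable_of_tendsto_metrizable (fun n => hZm n t)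
      (tendsto_pi_nhds.2 fun ω => hX t ω)
  · have hU : TendstoUniformly (fun n t => Z n t ω) (fun t => X t ω) Filter.atTop := by
      rw [Metric.tendstoUniformly_iff]
      intro ε hε
      have : Filter.Tendsto (fun n => A ω * r ^ n / (1 - r)) Filter.atTop (nhds 0) := by
        simpa using (hrt.const_mul (A ω)).div_const (1 - r)
      filter_upwards [this.eventually (gt_mem_nhds hε)] with n hn t
      rw [dist_comm]
      exact (dist_le_of_le_geometric_of_tendsto r (A ω) hr1 (fun n => hA ω n t) (hX t ω) n).trans_lt hn
    exact hU.continuous (Filter.Eventually.of_forall fun n => hZc n ω).frequently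
  · let q : ℕ → ℝ≥0 := fun n => (⌊2 ^ n * (t : ℝ)⌋₊ : ℝ≥0) / 2 ^ n
    have hq : ∀ n, |(q n : ℝ) - t| ≤ (1 / 2) ^ n := by
      intro n
      have hu0 : 0 ≤ 2 ^ n * (t : ℝ) := by positivity
      have f1 := Nat.floor_le hu0
      have f2 := Nat.lt_floor_add_one (2 ^ n * (t : ℝ))
      have : (q n : ℝ) - t = ((⌊2 ^ n * (t : ℝ)⌋₊ : ℝ) - 2 ^ n * t) / 2 ^ n := by
        simp only [q]; push_cast; field_simp
      rw [this, abs_div, abs_of_pos (by positivity : (0:ℝ) < 2 ^ n), one_div_pow]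
      gcongr
      rw [abs_le]; constructor <;> linarith
    let R : Ω → ENNReal := fun ω => ∑' n : ℕ, 2 ^ n * ‖Y (q n) ω - Y t ω‖ₑ ^ p
    have hm : ∀ n, Measurable fun ω => (2 : ENNReal) ^ n * ‖Y (q n) ω - Y t ω‖ₑ ^ p := fun n =>
      (((hYm _).sub (hYm _)).enorm.pow_const _).const_mul _
    have hRfin : ∀ᵐ ω ∂P, R ω ≠ ⊤ := by
      have : ∫⁻ ω, R ω ∂P ≠ ⊤ := by
        rw [lintegral_tsum fun n => (hm n).aemeasurable]
        refine ne_top_of_le_ne_top (hgeo K hK) ?_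
        refine ENNReal.tsum_le_tsum fun n => ?_
        have hc : ∫⁻ ω, (2 : ENNReal) ^ n * ‖Y (q n) ω - Y t ω‖ₑ ^ p ∂P =
            2 ^ n * ∫⁻ ω, ‖Y (q n) ω - Y t ω‖ₑ ^ p ∂P := by
          rw [lintegral_const_mul]
          exact ((hYm _).sub (hYm _)).enorm.pow_const _
        rw [hc]
        calc _ ≤ (2:ENNReal) ^ n * (K * 8⁻¹ ^ n) := by gcongr; exact hmom n _ _ (hq n)
          _ ≤ 2 ^ n * (2 ^ n * (K * 8⁻¹ ^ n)) :=
              mul_le_mul_right (le_mul_of_one_le_left zero_le (one_le_pow₀ (by norm_num))) _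
          _ = K * (2 * 2 * 8⁻¹) ^ n := by simp only [mul_pow]; ring
          _ = _ := by rw [h28]
      exact (ae_lt_top (Measurable.ennreal_tsum hm) this).mono fun ω h => h.ne
    filter_upwards [hSfin, hRfin] with ω h1 h2
    refine tendsto_nhds_unique (hX t ω) ?_
    rw [tendsto_iff_dist_tendsto_zero]
    refine squeeze_zero (g := fun n => (max 1 (S ω).toReal + max 1 (R ω).toReal) * r ^ n)
      (fun _ => dist_nonneg) (fun n => ?_) ?_
    · have hω : ω ∈ G := h1
      simp only [Z, Set.indicator_of_mem hω]
      have b1 := interp_sub_le (y := fun s => Y s ω) (fun s hs => hYT s hs ω) n (hinc ω hω n) t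
      have b2 : |Y (q n) ω - Y t ω| ≤ max 1 (R ω).toReal * r ^ n :=
        abs_le_of_pow_bound hp h2 (ENNReal.le_tsum n)
      rw [Real.dist_eq, add_mul]
      exact (abs_sub_le _ (Y (q n) ω) _).trans (add_le_add b1 b2)
    · simpa using hrt.const_mul (max 1 (S ω).toReal + max 1 (R ω).toReal)

open ProbabilityTheory in
theorem gauss_moment {v : ℝ≥0} (c : ℝ≥0) (hv : v = c ^ 2) (p : ℕ) :
    ∫⁻ x, ‖x‖ₑ ^ p ∂(gaussianReal 0 v) =
      (c : ENNReal) ^ p * ∫⁻ x, ‖x‖ₑ ^ p ∂(gaussianReal 0 1) := by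
  have h1 : (gaussianReal 0 1).map ((c : ℝ) * ·) = gaussianReal 0 v := by
    rw [gaussianReal_map_const_mul, mul_zero, mul_one]
    congr 1
    rw [hv]; ext; simp
  rw [← h1, lintegral_map (by fun_prop) (by fun_prop), ← lintegral_const_mul _ (by fun_prop)]
  refine lintegral_congr fun x => ?_
  rw [enorm_mul, mul_pow]
  congr 2
  rw [Real.enorm_eq_ofReal c.coe_nonneg]
  exact ENNReal.ofReal_coe_nnreal

open ProbabilityTheory in
theorem gauss_moment_ne_top (p : ℕ) : ∫⁻ x, ‖x‖ₑ ^ p ∂(gaussianReal 0 1) ≠ ⊤ := by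
  rcases eq_or_ne p 0 with rfl | hp
  · simp
  have h := (memLp_id_gaussianReal (μ := 0) (v := 1) (p : ℝ≥0)).eLpNorm_lt_top
  have := lintegral_rpow_enorm_lt_top_of_eLpNorm_lt_top (by simpa using hp) (by simp) h
  simpa using this.ne

theorem lin_comb_ae {Ω : Type} [MeasurableSpace Ω] {P : Measure Ω} {k : ℕ}
    (lam : Fin k → ℝ) (F : Fin k → Lp ℝ 2 P) (X : Fin k → Ω → ℝ) (hX : ∀ i, X i =ᵐ[P] F i) :
    (fun ω => ∑ i, lam i * X i ω) =ᵐ[P] (∑ i, lam i • F i : Lp ℝ 2 P) := by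
  have h1 : ((∑ i, lam i • F i : Lp ℝ 2 P) : Ω → ℝ) =ᵐ[P] ∑ i, ((lam i • F i : Lp ℝ 2 P) : Ω → ℝ) :=
    Lp.coeFn_finsetSum _ _
  have h2 : ∀ᵐ ω ∂P, ∀ i, ((lam i • F i : Lp ℝ 2 P) : Ω → ℝ) ω = lam i * X i ω := by
    rw [ae_all_iff]
    intro i
    filter_upwards [hX i, Lp.coeFn_smul (lam i) (F i)] with ω a b
    rw [b, a]; rfl
  filter_upwards [h1, h2] with ω a b
  rw [a, Finset.sum_apply]
  exact Finset.sum_congr rfl fun i _ => (b i).symm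

theorem main_aux (h : ℝ≥0 → ℝ≥0) (hcont : Continuous h)
    (hsupp : HasCompactSupport h) (h0 : h 0 = 0)
    (δ C : ℝ) (hδ0 : 0 < δ) (hC : 0 < C)
    (hHolder : ∀ s t : ℝ≥0, |(h s : ℝ) - (h t : ℝ)| ≤ C * |(s : ℝ) - (t : ℝ)| ^ δ) :
    ∃ (Ω : Type) (_ : MeasurableSpace Ω) (P : Measure Ω) (_ : IsProbabilityMeasure P)
      (X : ℝ≥0 → Ω → ℝ),
      (∀ s, Measurable (X s)) ∧
      (∀ ω, Continuous fun s => X s ω) ∧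
      (∀ (k : ℕ) (s : Fin k → ℝ≥0) (lam : Fin k → ℝ),
        Measure.map (fun ω => ∑ i, lam i * X (s i) ω) P =
          ProbabilityTheory.gaussianReal 0
            (Real.toNNReal (∑ i, ∑ j, lam i * lam j * minKernel h (s i) (s j)))) ∧
      (∀ᵐ ω ∂P, X 0 ω = 0) ∧
      (∀ s t, ∫ ω, X s ω * X t ω ∂P = minKernel h s t) := by
  obtain ⟨φ, hφ⟩ := exists_feature hcont
  obtain ⟨Ω, mΩ, P, hP, W, hW⟩ :=
    exists_isonormal (Lp ℝ 2 ((volume : Measure ℝ).prod (Measure.count : Measure ℕ)))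
  obtain ⟨T, hT⟩ : ∃ T : ℕ, ∀ s : ℝ≥0, (T : ℝ≥0) ≤ s → h s = 0 := by
    obtain ⟨b, hb⟩ := hsupp.isCompact.bddAbove
    obtain ⟨T, hT⟩ := exists_nat_gt b
    refine ⟨T, fun s hs => image_eq_zero_of_notMem_tsupport fun hmem => ?_⟩
    exact absurd (hb hmem) (not_le.2 (hT.trans_le hs))
  let Y : ℝ≥0 → Ω → ℝ := fun s => if h s = 0 then 0 else (W (φ s) : Ω → ℝ)
  have hY0 : ∀ s, h s = 0 → Y s = 0 := fun s hs => by simp [Y, hs]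
  have hYm : ∀ s, Measurable (Y s) := by
    intro s
    by_cases hs : h s = 0
    · rw [hY0 s hs]; exact measurable_const
    · simp only [Y, hs, if_false]
      exact (Lp.stronglyMeasurable _).measurable
  have hYW : ∀ s, Y s =ᵐ[P] W (φ s) := by
    intro s
    by_cases hs : h s = 0
    · have : φ s = 0 := by
        rw [← inner_self_eq_zero (𝕜 := ℝ), hφ, minKernel_self, hs]; rfl
      rw [hY0 s hs, this, map_zero]
      exact (Lp.coeFn_zero _ _ _).symm
    · simp only [Y, hs, if_false]; rfl
  obtain ⟨m, hm⟩ := exists_nat_gt (3 / δ)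
  have hm0 : m ≠ 0 := by
    rintro rfl
    have : 0 < 3 / δ := by positivity
    simp at hm; linarith
  have hmδ : 3 ≤ δ * m := by
    rw [div_lt_iff₀ hδ0] at hm; linarith
  have hnorm : ∀ s t, ‖φ s - φ t‖ ^ 2 ≤ 2 * C * |(s : ℝ) - t| ^ δ := by
    intro s t
    refine le_trans (le_of_eq ?_) (minKernel_incr hcont hδ0 hC hHolder s t)
    rw [norm_sub_sq_real, hφ, ← real_inner_self_eq_norm_sq, ← real_inner_self_eq_norm_sq, hφ, hφ,
      minKernel_self, minKernel_self]
    ring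
  have hmom : ∀ (n : ℕ) (s t : ℝ≥0), |(s : ℝ) - t| ≤ (1 / 2) ^ n →
      ∫⁻ ω, ‖Y s ω - Y t ω‖ₑ ^ (2 * m) ∂P ≤
        (ENNReal.ofReal ((2 * C) ^ m) *
          ∫⁻ x, ‖x‖ₑ ^ (2 * m) ∂(ProbabilityTheory.gaussianReal 0 1)) * 8⁻¹ ^ n := by
    intro n s t hst
    have e1 : ∫⁻ ω, ‖Y s ω - Y t ω‖ₑ ^ (2 * m) ∂P =
        ∫⁻ ω, ‖(W (φ s - φ t) : Ω → ℝ) ω‖ₑ ^ (2 * m) ∂P := by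
      refine lintegral_congr_ae ?_
      rw [map_sub]
      filter_upwards [hYW s, hYW t, Lp.coeFn_sub (W (φ s)) (W (φ t))] with ω a b c
      rw [a, b, c]; rfl
    have e2 : ∫⁻ ω, ‖(W (φ s - φ t) : Ω → ℝ) ω‖ₑ ^ (2 * m) ∂P =
        ∫⁻ x, ‖x‖ₑ ^ (2 * m) ∂(P.map (W (φ s - φ t))) := by
      rw [lintegral_map (by fun_prop) (Lp.stronglyMeasurable _).measurable]
    rw [e1, e2, hW, gauss_moment ‖φ s - φ t‖₊ rfl, mul_right_comm]
    gcongr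
    have e3 : (‖φ s - φ t‖ ^ 2) ^ m ≤ (2 * C) ^ m * (1 / 8) ^ n := by
      have i1 : |(s : ℝ) - t| ^ δ ≤ ((1 / 2 : ℝ) ^ n) ^ δ :=
        Real.rpow_le_rpow (abs_nonneg _) hst hδ0.le
      have i2 : (((1 / 2 : ℝ) ^ n) ^ δ) ^ m ≤ (1 / 8) ^ n := by
        rw [← Real.rpow_natCast (((1 / 2 : ℝ) ^ n) ^ δ), ← Real.rpow_mul (by positivity)]
        calc ((1 / 2 : ℝ) ^ n) ^ (δ * m) ≤ ((1 / 2 : ℝ) ^ n) ^ (3 : ℝ) :=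
              Real.rpow_le_rpow_of_exponent_ge (by positivity)
                (pow_le_one₀ (by norm_num) (by norm_num)) hmδ
          _ = (1 / 8) ^ n := by
              rw [show (3 : ℝ) = (3 : ℕ) by norm_num, Real.rpow_natCast, ← pow_mul, mul_comm,
                pow_mul]
              norm_num
      calc (‖φ s - φ t‖ ^ 2) ^ m ≤ (2 * C * ((1 / 2 : ℝ) ^ n) ^ δ) ^ m := by
            refine pow_le_pow_left₀ (by positivity) ((hnorm s t).trans ?_) m
            gcongr
        _ = (2 * C) ^ m * (((1 / 2 : ℝ) ^ n) ^ δ) ^ m := mul_pow _ _ _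
        _ ≤ _ := by gcongr
    have e4 := ENNReal.ofReal_le_ofReal e3
    rw [ENNReal.ofReal_mul (by positivity), ← pow_mul, ENNReal.ofReal_pow (norm_nonneg _),
      ENNReal.ofReal_pow (p := (1 / 8 : ℝ)) (by norm_num), ofReal_norm_eq_enorm, one_div,
      ENNReal.ofReal_inv_of_pos (by norm_num)] at e4
    simpa [enorm_eq_nnnorm] using e4
  obtain ⟨X, hXm, hXc, hXY⟩ := exists_cont_modification P Y hYm T
    (fun s hs ω => by rw [hY0 s (hT s hs)]; rfl) (2 * m) (by omega) _
    (ENNReal.mul_ne_top ENNReal.ofReal_ne_top (gauss_moment_ne_top (2 * m))) hmom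
  have hXW : ∀ s, X s =ᵐ[P] W (φ s) := fun s => (hXY s).trans (hYW s)
  refine ⟨Ω, mΩ, P, hP, X, hXm, hXc, fun k s lam => ?_, ?_, fun s t => ?_⟩
  · rw [Measure.map_congr (lin_comb_ae lam (fun i => W (φ (s i))) (fun i => X (s i))
      fun i => hXW (s i))]
    have : (∑ i, lam i • W (φ (s i))) = W (∑ i, lam i • φ (s i)) := by simp [map_sum]
    rw [this, hW]
    congr 1
    have e : ∑ i, ∑ j, lam i * lam j * minKernel h (s i) (s j) = ‖∑ i, lam i • φ (s i)‖ ^ 2 := by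
      rw [← real_inner_self_eq_norm_sq, sum_inner]
      refine Finset.sum_congr rfl fun i _ => ?_
      rw [inner_sum]
      refine Finset.sum_congr rfl fun j _ => ?_
      rw [real_inner_smul_left, real_inner_smul_right, hφ]; ring
    rw [e]
    ext
    rw [Real.coe_toNNReal _ (by positivity)]
    simp
  · filter_upwards [hXY 0] with ω hω
    rw [hω, hY0 0 h0]; rfl
  · rw [← hφ, ← W.inner_map_map, L2.inner_def]
    refine integral_congr_ae ?_
    filter_upwards [hXW s, hXW t] with ω a b
    simp only [a, b]
    simp [mul_comm]

/-- Let `h : ℝ≥0 → ℝ≥0` be continuous with compact support, `h 0 = 0`,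
and Hölder continuous with exponent `δ ∈ (0,1]` and constant `C > 0`. Then there exist a
probability space and a stochastic process `X` (the tip process of the Brownian snake
driven by `h`) with continuous sample paths such that every finite linear combination
`∑ᵢ λᵢ X_{sᵢ}` is a centered Gaussian random variable with variance
`∑ᵢ∑ⱼ λᵢ λⱼ c(sᵢ,sⱼ)`, where `c(s,t) = min_{r ∈ [s∧t, s∨t]} h(r)`. In particular
`X 0 = 0` almost surely and `E[X_s X_t] = c(s,t)`. -/
theorem exists_gaussian_process_minKernel (h : ℝ≥0 → ℝ≥0) (hcont : Continuous h)
    (hsupp : HasCompactSupport h) (h0 : h 0 = 0)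
    (δ C : ℝ) (hδ0 : 0 < δ) (hδ1 : δ ≤ 1) (hC : 0 < C)
    (hHolder : ∀ s t : ℝ≥0, |(h s : ℝ) - (h t : ℝ)| ≤ C * |(s : ℝ) - (t : ℝ)| ^ δ) :
    ∃ (Ω : Type) (_ : MeasureSpace Ω) (_ : IsProbabilityMeasure (volume : Measure Ω))
      (X : ℝ≥0 → Ω → ℝ),
      (∀ s, Measurable (X s)) ∧
      (∀ ω, Continuous fun s => X s ω) ∧
      (∀ (k : ℕ) (s : Fin k → ℝ≥0) (lam : Fin k → ℝ),
        Measure.map (fun ω => ∑ i, lam i * X (s i) ω) volume =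
          ProbabilityTheory.gaussianReal 0
            (Real.toNNReal (∑ i, ∑ j, lam i * lam j * minKernel h (s i) (s j)))) ∧
      (∀ᵐ ω ∂(volume : Measure Ω), X 0 ω = 0) ∧
      (∀ s t, ∫ ω, X s ω * X t ω = minKernel h s t) := by
  obtain ⟨Ω, mΩ, P, hP, X, hX⟩ := main_aux h hcont hsupp h0 δ C hδ0 hC hHolder
  exact ⟨Ω, { toMeasurableSpace := mΩ, volume := P }, hP, X, hX⟩
end

section
/- Let ζ : ℝ≥0 → ℝ≥0 be continuous with ζ(0) = 0 and ζ(u) = 0 for all u large enough, and let W, W' : ℝ≥0 → ℝ≥0 → ℝ both satisfy, together with this same ζ: W(s)(0) = 0, W(s)(t) = W(s)(min(t, ζ(s))) for all s,t, and the snake property (for all s ≤ s' and all t ≤ inf{ζ(r) : r ∈ [s,s']}, W(s)(t) = W(s')(t)), and likewise for W'. If the tip functions agree, i.e. W(s)(ζ(s)) = W'(s)(ζ(s)) for all s ≥ 0, then W = W': W(s)(t) = W'(s)(t) for all s, t ≥ 0. In other words, a snake trajectory is completely determined by its lifetime function and its tip function. -/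
open scoped NNReal

/-- A snake trajectory is completely determined by its lifetime function
and its tip function: if `W` and `W'` are path families with the same continuous lifetime
function `ζ` (vanishing at `0` and eventually), both started at `0`, frozen after their
lifetimes, and both satisfying the snake property, and if their tip functions agree
(`W s (ζ s) = W' s (ζ s)` for all `s`), then `W = W'`. -/
theorem snake_determined_by_tip (ζ : ℝ≥0 → ℝ≥0) (W W' : ℝ≥0 → ℝ≥0 → ℝ)
    (hζcont : Continuous ζ) (hζ0 : ζ 0 = 0)
    (hζsupp : ∃ T : ℝ≥0, ∀ u, T ≤ u → ζ u = 0)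
    (hW0 : ∀ s, W s 0 = 0)
    (hfrozen : ∀ s t, W s t = W s (min t (ζ s)))
    (hsnake : ∀ s s' : ℝ≥0, s ≤ s' → ∀ t : ℝ≥0,
      (∀ r ∈ Set.Icc s s', t ≤ ζ r) → W s t = W s' t)
    (hW0' : ∀ s, W' s 0 = 0)
    (hfrozen' : ∀ s t, W' s t = W' s (min t (ζ s)))
    (hsnake' : ∀ s s' : ℝ≥0, s ≤ s' → ∀ t : ℝ≥0,
      (∀ r ∈ Set.Icc s s', t ≤ ζ r) → W' s t = W' s' t)
    (htip : ∀ s, W s (ζ s) = W' s (ζ s)) :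
    ∀ s t, W s t = W' s t := by
  have key : ∀ s t, t ≤ ζ s → W s t = W' s t := by
    intro s t hts
    have hcomp : IsCompact (Set.Icc 0 s ∩ ζ ⁻¹' {t}) :=
      isCompact_Icc.inter_right (isClosed_singleton.preimage hζcont)
    have hne : (Set.Icc 0 s ∩ ζ ⁻¹' {t}).Nonempty := by
      have h := intermediate_value_Icc (zero_le : (0 : ℝ≥0) ≤ s) hζcont.continuousOn
      obtain ⟨x, hx, hxt⟩ := h (show t ∈ Set.Icc (ζ 0) (ζ s) from ⟨by simp [hζ0], hts⟩)
      exact ⟨x, hx, hxt⟩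
    obtain ⟨u, ⟨⟨-, hus⟩, hut⟩, hmax⟩ := hcomp.exists_isGreatest hne
    have hut : ζ u = t := hut
    have hge : ∀ r ∈ Set.Icc u s, t ≤ ζ r := by
      rintro r ⟨hur, hrs⟩
      by_contra hlt
      have hlt : ζ r < t := not_le.mp hlt
      obtain ⟨x, hx, hxt⟩ := intermediate_value_Icc hrs hζcont.continuousOn
        (show t ∈ Set.Icc (ζ r) (ζ s) from ⟨hlt.le, hts⟩)
      have hxu : x ≤ u := hmax ⟨⟨by simp, hx.2⟩, hxt⟩
      have : r = u := le_antisymm (hx.1.trans hxu) hur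
      rw [this, hut] at hlt
      exact lt_irrefl _ hlt
    rw [← hsnake u s hus t hge, ← hsnake' u s hus t hge, ← hut]
    exact htip u
  intro s t
  rw [hfrozen s t, hfrozen' s t]
  exact key s _ (min_le_right _ _)
end

section
/- Let X be a nonempty set, Z : X → ℝ, and D° : X × X → ℝ a symmetric nonnegative function such that D°(a,b) ≥ |Z(a) − Z(b)| for all a, b ∈ X. Let D(a,b) = inf{ ∑_{i=1}^k D°(a_{i−1}, a_i) : k ≥ 1, a₀ = a, a_k = b }. Suppose a_* ∈ X satisfies Z(a_*) ≤ Z(b) for all b ∈ X and D°(a_*, b) ≤ Z(b) − Z(a_*) for all b ∈ X. Then D(a_*, b) = Z(b) − Z(a_*) for every b ∈ X. -/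
/-- The chain-infimum construction: `chainDist D0 a b` is the infimum over all finite
chains `a = a₀, a₁, …, a_k = b` (with `k ≥ 1`) of `∑ᵢ D0 (a_{i-1}) (a_i)`. -/
noncomputable def chainDist {X : Type*} (D0 : X → X → ℝ) (a b : X) : ℝ :=
  sInf {x : ℝ | ∃ (k : ℕ) (f : ℕ → X), 1 ≤ k ∧ f 0 = a ∧ f k = b ∧
    x = ∑ i ∈ Finset.range k, D0 (f i) (f (i + 1))}

/-- Let `Z : X → ℝ` and let `D0` be a symmetric nonnegative function
with `D0 a b ≥ |Z a - Z b|` for all `a, b`. Suppose `a⋆ ∈ X` has minimal label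
(`Z a⋆ ≤ Z b` for all `b`) and satisfies `D0 a⋆ b ≤ Z b - Z a⋆` for all `b`. Then the
chain-infimum `D = chainDist D0` satisfies `D a⋆ b = Z b - Z a⋆` for every `b`: distances
from the minimizing point are given by the labels. -/
theorem chainDist_from_min_label {X : Type*} [Nonempty X] (Z : X → ℝ) (D0 : X → X → ℝ)
    (hsymm : ∀ a b, D0 a b = D0 b a) (hnonneg : ∀ a b, 0 ≤ D0 a b)
    (hZ : ∀ a b, |Z a - Z b| ≤ D0 a b)
    (astar : X) (hmin : ∀ b, Z astar ≤ Z b)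
    (hupper : ∀ b, D0 astar b ≤ Z b - Z astar) :
    ∀ b, chainDist D0 astar b = Z b - Z astar := by
  intro b
  have hle : D0 astar b = Z b - Z astar := by
    refine le_antisymm (hupper b) ?_
    have h := hZ astar b
    rw [abs_sub_comm] at h
    exact (le_abs_self _).trans h
  refine IsLeast.csInf_eq ⟨?_, ?_⟩
  · refine ⟨1, fun n => if n = 0 then astar else b, le_refl _, by simp, by simp, ?_⟩
    simp [hle]
  · rintro x ⟨k, f, _, h0, hk, rfl⟩
    rw [← h0, ← hk, ← Finset.sum_range_sub (fun i => Z (f i)) k]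
    refine Finset.sum_le_sum fun i _ => ?_
    have h := hZ (f i) (f (i + 1))
    rw [abs_sub_comm] at h
    exact (le_abs_self _).trans h
end
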